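/- arXiv:1005.4736 — 2 statements merged into one kernel-verified Lean document; each statement's English description precedes it below -/
import Mathlib

section
/- Let G = A ∗ B be the free product of two finite groups A and B, and let u_1, ..., u_m (m ≥ 2) be nontrivial elements of the Cartesian subgroup C of G such that no two of them belong to conjugate cyclic subgroups (i.e. for i ≠ j there is no element z ∈ G and no g ∈ G with u_i ∈ ⟨z⟩ and u_j ∈ g⟨z⟩g⁻¹). Suppose moreover that for each i one has u_i = (u_i')^{m_i} where u_i' ∈ G is not a proper power and, if m_i > 1, then (u_i')^{m'} ∉ C for every positive divisor m' of m_i with m' ≠ m_i. Let π be a finite set of prime numbers. Then there exist a prime p ∉ π and a homomorphism φ of G onto a finite group such that every φ(u_i) is a nontrivial p-element, and the set {u_1, ..., u_m} is the union of two disjoint nonempty subsets α and β such that the order of φ(u_i) is strictly greater than the order of φ(u_j) whenever u_i ∈ α and u_j ∈ β. -/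
/-- The Cartesian subgroup of the free product `A ∗ B`: the kernel of the natural
homomorphism `A ∗ B → A × B`. -/
def cartesianSubgroup (A B : Type*) [Group A] [Group B] :
    Subgroup (Monoid.Coprod A B) :=
  (Monoid.Coprod.toProd : Monoid.Coprod A B →* A × B).ker

/-- An element is not a proper power if it can be written as `v ^ k` with `k` a positive
integer only for `k = 1`. -/
def IsNotProperPower {G : Type*} [Group G] (u : G) : Prop :=
  ∀ (v : G) (k : ℕ), 0 < k → u = v ^ k → k = 1

namespace CartesianSplitting

open Monoid

section Words

variable {A B : Type*} [Group A] [Group B]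

/-- The element `a₀ b₀ a₁ b₁ ⋯ aₙ₋₁ bₙ₋₁` of `A ∗ B`, where `x i = (aᵢ, bᵢ)`. -/
def pathWord (x : ℕ → A × B) : ℕ → Coprod A B
  | 0 => 1
  | n + 1 => pathWord x n * (Coprod.inl (x n).1 * Coprod.inr (x n).2)

@[simp] lemma pathWord_zero (x : ℕ → A × B) : pathWord x 0 = 1 := rfl

lemma pathWord_succ (x : ℕ → A × B) (n : ℕ) :
    pathWord x (n + 1) = pathWord x n * (Coprod.inl (x n).1 * Coprod.inr (x n).2) := rfl

lemma pathWord_add (x : ℕ → A × B) (m n : ℕ) :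
    pathWord x (m + n) = pathWord x m * pathWord (fun i => x (m + i)) n := by
  induction n with
  | zero => simp
  | succ n ih => rw [← add_assoc, pathWord_succ, ih, pathWord_succ, mul_assoc]

lemma pathWord_succ_left (x : ℕ → A × B) (n : ℕ) :
    pathWord x (n + 1) = Coprod.inl (x 0).1 * Coprod.inr (x 0).2 *
      pathWord (fun i => x (i + 1)) n := by
  rw [add_comm, pathWord_add]
  simp [pathWord_succ, add_comm]

/-- The element of `A ∗ B` spelled by a list of letters. -/
def spell (l : List (A ⊕ B)) : Coprod A B :=
  (l.map (Sum.elim Coprod.inl Coprod.inr)).prod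

/-- A list of nontrivial letters taken alternately from `A` and `B`. -/
def IsReduced (l : List (A ⊕ B)) : Prop :=
  (∀ c ∈ l, c ≠ Sum.inl 1 ∧ c ≠ Sum.inr 1) ∧ l.IsChain fun c d => c.isLeft ≠ d.isLeft

end Words

section NormalForm

universe v w

variable {A : Type v} {B : Type w} [Group A] [Group B]

/-- The two factors of `A ∗ B`, as a family in a common universe. -/
def factor (A : Type v) (B : Type w) : Bool → Type (max v w)
  | true => ULift.{w} A
  | false => ULift.{v} B

instance factorGroup : ∀ i, Group (factor A B i)
  | true => inferInstanceAs (Group (ULift.{w} A))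
  | false => inferInstanceAs (Group (ULift.{v} B))

/-- A letter, as an element of one of the two factors. -/
def toFactor : A ⊕ B → Σ i, factor A B i
  | Sum.inl a => ⟨true, (ULift.up a : ULift.{w} A)⟩
  | Sum.inr b => ⟨false, (ULift.up b : ULift.{v} B)⟩

/-- The comparison map from the binary to the indexed free product. -/
def toCoprodI : Coprod A B →* CoprodI (factor A B) :=
  Coprod.lift
    ((CoprodI.of (M := factor A B) (i := true)).comp
      (MulEquiv.ulift.symm.toMonoidHom : A →* ULift.{w} A))
    ((CoprodI.of (M := factor A B) (i := false)).comp
      (MulEquiv.ulift.symm.toMonoidHom : B →* ULift.{v} B))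

lemma toFactor_injective {A : Type v} {B : Type w} :
    Function.Injective (toFactor : A ⊕ B → Σ i, factor A B i) := by
  let f : (Σ i, factor A B i) → A ⊕ B
    | ⟨true, z⟩ => Sum.inl (ULift.down.{w} (α := A) z)
    | ⟨false, z⟩ => Sum.inr (ULift.down.{v} (α := B) z)
  refine Function.LeftInverse.injective (g := f) ?_
  rintro (a | b) <;> rfl

lemma toFactor_fst {A : Type v} {B : Type w} (c : A ⊕ B) : (toFactor c).1 = c.isLeft := by
  cases c <;> rfl

lemma toFactor_snd_ne_one {c : A ⊕ B} (h : c ≠ Sum.inl 1 ∧ c ≠ Sum.inr 1) :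
    (toFactor c).2 ≠ 1 := by
  rcases c with a | b
  · intro h1
    exact h.1 (congrArg (fun z : ULift.{w} A => Sum.inl z.down) h1)
  · intro h1
    exact h.2 (congrArg (fun z : ULift.{v} B => Sum.inr z.down) h1)

lemma toCoprodI_spell (l : List (A ⊕ B)) :
    toCoprodI (spell l) = ((l.map toFactor).map fun c => CoprodI.of c.2).prod := by
  simp only [spell, map_list_prod, List.map_map]
  congr 1
  refine List.map_congr_left fun c _ => ?_
  rcases c with a | b
  · exact Coprod.lift_apply_inl _ _ a
  · exact Coprod.lift_apply_inr _ _ b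

/-- Uniqueness of normal forms in the free product. -/
lemma IsReduced.spell_injOn {l l' : List (A ⊕ B)} (hl : IsReduced l) (hl' : IsReduced l')
    (h : spell l = spell l') : l = l' := by
  have key : ∀ l : List (A ⊕ B), IsReduced l →
      ∃ W : CoprodI.Word (factor A B), W.toList = l.map toFactor ∧
        W.prod = toCoprodI (spell l) := by
    intro l hl
    refine ⟨⟨l.map toFactor, ?_, ?_⟩, rfl, (toCoprodI_spell l).symm⟩
    · intro c hc
      obtain ⟨d, hd, rfl⟩ := List.mem_map.1 hc
      exact toFactor_snd_ne_one (hl.1 d hd)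
    · rw [List.isChain_map]
      simpa only [toFactor_fst] using hl.2
  obtain ⟨W, hW, hW'⟩ := key l hl
  obtain ⟨V, hV, hV'⟩ := key l' hl'
  have hWV : W = V := by
    classical
    apply CoprodI.Word.equiv.symm.injective
    change W.prod = V.prod
    rw [hW', hV', h]
  subst hWV
  exact List.map_injective_iff.2 toFactor_injective (hW.symm.trans hV)

end NormalForm

section Paths

variable {A B : Type*} [Group A] [Group B]

/-- The letters `a₀, b₀, …, aₙ₋₁, bₙ₋₁`. -/
def pathLetters : ℕ → (ℕ → A × B) → List (A ⊕ B)
  | 0, _ => []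
  | n + 1, x => Sum.inl (x 0).1 :: Sum.inr (x 0).2 :: pathLetters n fun i => x (i + 1)

lemma length_pathLetters {A B : Type*} (n : ℕ) (x : ℕ → A × B) :
    (pathLetters n x).length = 2 * n := by
  induction n generalizing x with
  | zero => rfl
  | succ n ih => simp only [pathLetters, List.length_cons, ih]; ring

@[simp] lemma spell_nil : spell ([] : List (A ⊕ B)) = 1 := rfl

@[simp] lemma spell_inl_cons (a : A) (l : List (A ⊕ B)) :
    spell (Sum.inl a :: l) = Coprod.inl a * spell l := by simp [spell]

@[simp] lemma spell_inr_cons (b : B) (l : List (A ⊕ B)) :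
    spell (Sum.inr b :: l) = Coprod.inr b * spell l := by simp [spell]

@[simp] lemma spell_append (l l' : List (A ⊕ B)) : spell (l ++ l') = spell l * spell l' := by
  simp [spell]

@[simp] lemma spell_pathLetters (n : ℕ) (x : ℕ → A × B) :
    spell (pathLetters n x) = pathWord x n := by
  induction n generalizing x with
  | zero => rfl
  | succ n ih => simp [pathLetters, ih, pathWord_succ_left, mul_assoc]

lemma pathLetters_injOn {A B : Type*} {n : ℕ} {x y : ℕ → A × B}
    (h : pathLetters n x = pathLetters n y) : ∀ i < n, x i = y i := by
  induction n generalizing x y with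
  | zero => intro i hi; omega
  | succ n ih =>
    simp only [pathLetters, List.cons.injEq, Sum.inl.injEq, Sum.inr.injEq] at h
    intro i hi
    rcases i with _ | i
    · exact Prod.ext h.1 h.2.1
    · exact ih h.2.2 i (by omega)

lemma isReduced_inl_cons {a : A} {l : List (A ⊕ B)} (ha : a ≠ 1) (hl : IsReduced l)
    (h : ∀ c ∈ l.head?, c.isLeft = false) : IsReduced (Sum.inl a :: l) := by
  refine ⟨?_, List.isChain_cons.2 ⟨fun c hc => ?_, hl.2⟩⟩
  · simpa [ha] using hl.1
  · simp [h c hc]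

lemma isReduced_inr_cons {b : B} {l : List (A ⊕ B)} (hb : b ≠ 1) (hl : IsReduced l)
    (h : ∀ c ∈ l.head?, c.isLeft = true) : IsReduced (Sum.inr b :: l) := by
  refine ⟨?_, List.isChain_cons.2 ⟨fun c hc => ?_, hl.2⟩⟩
  · simpa [hb] using hl.1
  · simp [h c hc]

lemma isReduced_nil : IsReduced ([] : List (A ⊕ B)) := ⟨by simp, List.isChain_nil⟩

lemma isReduced_pathLetters_append {x : ℕ → A × B} (hx : ∀ i, (x i).1 ≠ 1 ∧ (x i).2 ≠ 1)
    {l : List (A ⊕ B)} (hl : IsReduced l) (h : ∀ c ∈ l.head?, c.isLeft = true) (n : ℕ) :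
    IsReduced (pathLetters n x ++ l) ∧ ∀ c ∈ (pathLetters n x ++ l).head?, c.isLeft = true := by
  induction n generalizing x with
  | zero => exact ⟨hl, h⟩
  | succ n ih =>
    obtain ⟨h1, h2⟩ := ih fun i => hx (i + 1)
    refine ⟨isReduced_inl_cons (hx 0).1 (isReduced_inr_cons (hx 0).2 h1 h2) ?_, ?_⟩
    · simp
    · simp [pathLetters]

lemma isReduced_pathLetters {x : ℕ → A × B} (hx : ∀ i, (x i).1 ≠ 1 ∧ (x i).2 ≠ 1) (n : ℕ) :
    IsReduced (pathLetters n x) ∧ ∀ c ∈ (pathLetters n x).head?, c.isLeft = true := by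
  simpa using isReduced_pathLetters_append hx isReduced_nil (by simp) n

lemma eq_of_pathWord_eq {x y : ℕ → A × B} (hx : ∀ i, (x i).1 ≠ 1 ∧ (x i).2 ≠ 1)
    (hy : ∀ i, (y i).1 ≠ 1 ∧ (y i).2 ≠ 1) {n : ℕ} (h : pathWord x n = pathWord y n) :
    ∀ i < n, x i = y i := by
  refine pathLetters_injOn ((isReduced_pathLetters hx n).1.spell_injOn
    (isReduced_pathLetters hy n).1 ?_)
  simpa using h

lemma inr_mul_pathWord_ne {x y : ℕ → A × B} (hx : ∀ i, (x i).1 ≠ 1 ∧ (x i).2 ≠ 1)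
    (hy : ∀ i, (y i).1 ≠ 1 ∧ (y i).2 ≠ 1) (n : ℕ) {b : B} (hb : b ≠ 1) :
    Coprod.inr b * pathWord x (n + 1) ≠ pathWord y (n + 1) * Coprod.inr b := by
  intro h
  have hL := isReduced_inr_cons hb (isReduced_pathLetters hx (n + 1)).1
    (isReduced_pathLetters hx (n + 1)).2
  by_cases hb' : (y n).2 * b = 1
  · have hR := (isReduced_pathLetters_append hy (l := [Sum.inl (y n).1])
      (isReduced_inl_cons (hy n).1 isReduced_nil (by simp)) (by simp) n).1
    have := congrArg List.length (hL.spell_injOn hR ?_)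
    · simp [length_pathLetters] at this
    · simp [h, pathWord_succ y n, mul_assoc, ← map_mul, hb']
  · have hR := (isReduced_pathLetters_append hy (l := [Sum.inl (y n).1, Sum.inr ((y n).2 * b)])
      (isReduced_inl_cons (hy n).1 (isReduced_inr_cons hb' isReduced_nil (by simp)) (by simp))
      (by simp) n).1
    have := congrArg List.length (hL.spell_injOn hR ?_)
    · simp [length_pathLetters] at this
      omega
    · simp [h, pathWord_succ y n, mul_assoc]

lemma inl_mul_pathWord_ne {x y : ℕ → A × B} (hx : ∀ i, (x i).1 ≠ 1 ∧ (x i).2 ≠ 1)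
    (hy : ∀ i, (y i).1 ≠ 1 ∧ (y i).2 ≠ 1) (n : ℕ) {a : A} (ha : a ≠ 1) :
    Coprod.inl a * pathWord x (n + 1) ≠ pathWord y (n + 1) * Coprod.inl a := by
  intro h
  have hR := (isReduced_pathLetters_append hy (l := [Sum.inl a])
    (isReduced_inl_cons ha isReduced_nil (by simp)) (by simp) (n + 1)).1
  have hx' := isReduced_pathLetters (fun i => hx (i + 1)) n
  have hx0 := isReduced_inr_cons (hx 0).2 hx'.1 hx'.2
  by_cases ha' : a * (x 0).1 = 1
  · have := congrArg List.length (hx0.spell_injOn hR ?_)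
    · simp [length_pathLetters] at this
    · simp [← h, pathWord_succ_left x n, ← mul_assoc, ← map_mul, ha']
  · have := congrArg List.length ((isReduced_inl_cons ha' hx0 (by simp)).spell_injOn hR ?_)
    · simp [length_pathLetters] at this
      omega
    · simp [← h, pathWord_succ_left x n, mul_assoc]

end Paths

section CyclicReduction

variable {A B : Type*} [Group A] [Group B]

/-- The element `a₁ b₁ ⋯ aₖ bₖ` attached to a list of pairs `(aᵢ, bᵢ)`. -/
def pairsProd (l : List (A × B)) : Coprod A B :=
  (l.map fun c => Coprod.inl c.1 * Coprod.inr c.2).prod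

@[simp] lemma pairsProd_nil : pairsProd ([] : List (A × B)) = 1 := rfl

@[simp] lemma pairsProd_cons (c : A × B) (l : List (A × B)) :
    pairsProd (c :: l) = Coprod.inl c.1 * Coprod.inr c.2 * pairsProd l := by
  simp [pairsProd]

@[simp] lemma pairsProd_append (l l' : List (A × B)) :
    pairsProd (l ++ l') = pairsProd l * pairsProd l' := by
  simp [pairsProd]

lemma exists_pairsProd_eq (g : Coprod A B) : ∃ l, pairsProd l = g := by
  induction g using Coprod.induction_on with
  | inl a => exact ⟨[(a, 1)], by simp⟩
  | inr b => exact ⟨[(1, b)], by simp⟩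
  | mul g h hg hh =>
    obtain ⟨l, rfl⟩ := hg
    obtain ⟨l', rfl⟩ := hh
    exact ⟨l ++ l', by simp⟩

lemma mem_cartesianSubgroup {g : Coprod A B} :
    g ∈ cartesianSubgroup A B ↔ Coprod.toProd g = 1 := Iff.rfl

instance : (cartesianSubgroup A B).Normal :=
  inferInstanceAs (Coprod.toProd : Coprod A B →* A × B).ker.Normal

lemma inl_mul_inr_mem_cartesianSubgroup {a : A} {b : B} :
    Coprod.inl a * Coprod.inr b ∈ cartesianSubgroup A B ↔ a = 1 ∧ b = 1 := by
  simp [mem_cartesianSubgroup, Prod.ext_iff]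

lemma exists_conj_pairsProd (l : List (A × B)) (hC : pairsProd l ∈ cartesianSubgroup A B)
    (h1 : pairsProd l ≠ 1) :
    ∃ (h : Coprod A B) (l' : List (A × B)), l' ≠ [] ∧ (∀ c ∈ l', c.1 ≠ 1 ∧ c.2 ≠ 1) ∧
      pairsProd l = h * pairsProd l' * h⁻¹ := by
  by_cases hl : ∀ c ∈ l, c.1 ≠ 1 ∧ c.2 ≠ 1
  · exact ⟨1, l, by rintro rfl; simp at h1, hl, by simp⟩
  have key : ∀ (k : Coprod A B) (l₁ : List (A × B)), l₁.length < l.length →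
      pairsProd l = k * pairsProd l₁ * k⁻¹ → ∃ (h : Coprod A B) (l' : List (A × B)), l' ≠ [] ∧
        (∀ c ∈ l', c.1 ≠ 1 ∧ c.2 ≠ 1) ∧ pairsProd l = h * pairsProd l' * h⁻¹ := by
    intro k l₁ hlt hk
    have hk' : pairsProd l₁ = k⁻¹ * pairsProd l * k⁻¹⁻¹ := by rw [hk]; group
    obtain ⟨h, l', h0, h2, h3⟩ := exists_conj_pairsProd l₁
      (hk' ▸ Subgroup.Normal.conj_mem inferInstance _ hC _)
      (fun hone => h1 (by rw [hk, hone]; group))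
    exact ⟨k * h, l', h0, h2, by rw [hk, h3]; group⟩
  push Not at hl
  obtain ⟨⟨a, b⟩, hc, hab⟩ := hl
  obtain ⟨s, t, rfl⟩ := List.append_of_mem hc
  by_cases ha : a = 1
  · subst ha
    rcases List.eq_nil_or_concat (t ++ s) with h0 | ⟨r, ⟨a', b'⟩, hr⟩
    · obtain ⟨rfl, rfl⟩ := List.append_eq_nil_iff.1 h0
      simp only [List.nil_append, pairsProd_cons, pairsProd_nil, mul_one] at hC h1
      obtain ⟨-, rfl⟩ := inl_mul_inr_mem_cartesianSubgroup.1 hC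
      simp at h1
    · have hr' := congrArg pairsProd hr
      simp only [pairsProd_append, List.concat_eq_append, pairsProd_cons, pairsProd_nil,
        mul_one] at hr'
      refine key (pairsProd s * Coprod.inr b) (r ++ [(a', b' * b)]) ?_ ?_
      · have := congrArg List.length hr
        simp at this ⊢
        omega
      · rw [← eq_mul_inv_iff_mul_eq] at hr'
        simp [hr', mul_assoc]
  · obtain rfl : b = 1 := hab ha
    rcases h0 : t ++ s with _ | ⟨⟨a', b'⟩, r⟩
    · obtain ⟨rfl, rfl⟩ := List.append_eq_nil_iff.1 h0
      simp only [List.nil_append, pairsProd_cons, pairsProd_nil, mul_one] at hC h1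
      obtain ⟨rfl, -⟩ := inl_mul_inr_mem_cartesianSubgroup.1 hC
      simp at h1
    · have hr' := congrArg pairsProd h0
      simp only [pairsProd_append, pairsProd_cons] at hr'
      refine key (pairsProd s) ((a * a', b') :: r) ?_ ?_
      · have := congrArg List.length h0
        simp at this ⊢
        omega
      · rw [← eq_mul_inv_iff_mul_eq] at hr'
        simp [hr', mul_assoc]
termination_by l.length

lemma pathWord_eq_pairsProd (x : ℕ → A × B) (n : ℕ) :
    pathWord x n = pairsProd ((List.range n).map x) := by
  induction n with
  | zero => rfl
  | succ n ih => simp [pathWord_succ, ih, List.range_succ]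

lemma exists_conj_pathWord {g : Coprod A B} (hC : g ∈ cartesianSubgroup A B) (h1 : g ≠ 1) :
    ∃ (h : Coprod A B) (x : ℕ → A × B) (n : ℕ), 0 < n ∧ (∀ i, (x i).1 ≠ 1 ∧ (x i).2 ≠ 1) ∧
      Function.Periodic x n ∧ g = h * pathWord x n * h⁻¹ := by
  obtain ⟨l₀, rfl⟩ := exists_pairsProd_eq g
  obtain ⟨h, l, h0, h2, h3⟩ := exists_conj_pairsProd l₀ hC h1
  have hpos : 0 < l.length := List.length_pos_iff.2 h0
  refine ⟨h, fun i => l[i % l.length]'(Nat.mod_lt _ hpos), l.length, hpos,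
    fun i => h2 _ (List.getElem_mem _), fun i => by simp, ?_⟩
  rw [h3, pathWord_eq_pairsProd]
  congr 3
  refine List.ext_getElem (by simp) fun i hi _ => ?_
  simp [Nat.mod_eq_of_lt hi]

lemma Periodic.pathWord_mul {x : ℕ → A × B} {n : ℕ} (hx : Function.Periodic x n) (k r : ℕ) :
    pathWord x (k * n + r) = pathWord x n ^ k * pathWord x r := by
  induction k with
  | zero => simp
  | succ k ih =>
    have h : (fun i => x (n + i)) = x := funext fun i => by rw [add_comm]; exact hx i
    rw [show (k + 1) * n + r = n + (k * n + r) by ring, pathWord_add, h, ih, pow_succ', mul_assoc]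

/-- `x` describes a bi-infinite periodic reduced word whose shortest period lying in the
Cartesian subgroup has length `n`. -/
structure IsPrimitivePath (x : ℕ → A × B) (n : ℕ) : Prop where
  pos : 0 < n
  ne_one : ∀ i, (x i).1 ≠ 1 ∧ (x i).2 ≠ 1
  periodic : Function.Periodic x n
  mem : pathWord x n ∈ cartesianSubgroup A B
  le_of_periodic : ∀ r, 0 < r → Function.Periodic x r →
    pathWord x r ∈ cartesianSubgroup A B → n ≤ r

lemma exists_isPrimitivePath {g : Coprod A B} (hC : g ∈ cartesianSubgroup A B) (h1 : g ≠ 1) :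
    ∃ (h : Coprod A B) (x : ℕ → A × B) (n k : ℕ), IsPrimitivePath x n ∧ 0 < k ∧
      g = h * pathWord x n ^ k * h⁻¹ := by
  classical
  obtain ⟨h, x, m, hm, hx, hper, rfl⟩ := exists_conj_pathWord hC h1
  have hmC : pathWord x m ∈ cartesianSubgroup A B := by
    have := Subgroup.Normal.conj_mem inferInstance _ hC h⁻¹
    rwa [show h⁻¹ * (h * pathWord x m * h⁻¹) * h⁻¹⁻¹ = pathWord x m by group] at this
  have hex : ∃ n, 0 < n ∧ Function.Periodic x n ∧ pathWord x n ∈ cartesianSubgroup A B :=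
    ⟨m, hm, hper, hmC⟩
  obtain ⟨hn, hnper, hnC⟩ := Nat.find_spec hex
  set n := Nat.find hex
  have hmin : ∀ r, 0 < r → Function.Periodic x r →
    pathWord x r ∈ cartesianSubgroup A B → n ≤ r := fun r h0 hr hC => Nat.find_min' hex ⟨h0, hr, hC⟩
  have hdecomp := Periodic.pathWord_mul hnper (m / n) (m % n)
  rw [Nat.div_add_mod'] at hdecomp
  have hmod : m % n = 0 := by
    by_contra hne
    have := hmin (m % n) (Nat.pos_of_ne_zero hne) (fun i => ?_) ?_
    · exact absurd (Nat.mod_lt m hn) (by omega)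
    · have h2 := hper i
      have h3 : x (i + m % n + (m / n) * n) = x (i + m % n) := hnper.nat_mul (m / n) _
      rw [← h3, ← h2, add_assoc, Nat.mod_add_div']
    · rw [hdecomp] at hmC
      exact (Subgroup.mul_mem_cancel_left _ (Subgroup.pow_mem _ hnC _)).1 hmC
  refine ⟨h, x, n, m / n, ⟨hn, hx, hnper, hnC, hmin⟩, ?_, ?_⟩
  · refine Nat.div_pos (Nat.le_of_dvd hm (Nat.dvd_of_mod_eq_zero hmod)) hn
  · rw [hdecomp, hmod]
    simp

lemma pathWord_mul_pathWord_shift {x : ℕ → A × B} {n : ℕ} (hx : Function.Periodic x n) (r : ℕ) :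
    pathWord x n * pathWord x r = pathWord x r * pathWord (fun i => x (r + i)) n := by
  have h := Periodic.pathWord_mul hx 1 r
  rw [one_mul, pow_one, add_comm, pathWord_add] at h
  exact h.symm

lemma IsPrimitivePath.shift {x : ℕ → A × B} {n : ℕ} (hx : IsPrimitivePath x n) (s : ℕ) :
    IsPrimitivePath (fun i => x (s + i)) n where
  pos := hx.pos
  ne_one i := hx.ne_one _
  periodic i := (congrArg x (add_assoc s i n).symm).trans (hx.periodic (s + i))
  mem := by
    have h := pathWord_mul_pathWord_shift hx.periodic s
    rw [← inv_mul_eq_iff_eq_mul, ← mul_assoc] at h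
    rw [← h]
    simpa using Subgroup.Normal.conj_mem inferInstance _ hx.mem (pathWord x s)⁻¹
  le_of_periodic r hr hper hC := by
    have hper' : Function.Periodic x r := by
      intro i
      have h1 := hx.periodic.nat_mul s
      have h2 : s ≤ s * n := Nat.le_mul_of_pos_right _ hx.pos
      have h3 := hper (i + s * n - s)
      simp only [] at h3
      rw [show s + (i + s * n - s + r) = i + r + s * n by omega,
        show s + (i + s * n - s) = i + s * n by omega] at h3
      rw [← h1 i, ← h1 (i + r)]
      exact h3
    refine hx.le_of_periodic r hr hper' ?_
    have h := pathWord_mul_pathWord_shift hper' s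
    rw [← eq_mul_inv_iff_mul_eq] at h
    rw [h]
    exact Subgroup.Normal.conj_mem inferInstance _ hC _

/-- An element of one of the two factors of `A ∗ B`. -/
def IsLetter (β : Coprod A B) : Prop := (∃ a, β = Coprod.inl a) ∨ ∃ b, β = Coprod.inr b

lemma IsPrimitivePath.not_commute {x : ℕ → A × B} {n : ℕ} (hx : IsPrimitivePath x n) {r : ℕ}
    (hr : 0 < r) (hrn : r < n) {β : Coprod A B} (hβ : IsLetter β)
    (hC : pathWord x r * β ∈ cartesianSubgroup A B) :
    pathWord x r * β * pathWord x n ≠ pathWord x n * (pathWord x r * β) := by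
  intro h
  rw [← mul_assoc, pathWord_mul_pathWord_shift hx.periodic, mul_assoc, mul_assoc,
    mul_right_inj] at h
  obtain ⟨k, rfl⟩ : ∃ k, n = k + 1 := ⟨n - 1, by omega⟩
  by_cases h1 : β = 1
  · rw [h1, one_mul, mul_one] at h
    rw [h1, mul_one] at hC
    have heq := eq_of_pathWord_eq hx.ne_one (hx.shift r).ne_one h
    refine absurd (hx.le_of_periodic r hr (fun i => ?_) hC) (by omega)
    have hmod := heq (i % (k + 1)) (Nat.mod_lt _ (by omega))
    rw [hx.periodic.map_mod_nat, (hx.shift r).periodic.map_mod_nat] at hmod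
    rw [hmod, add_comm]
  · rcases hβ with ⟨a, rfl⟩ | ⟨b, rfl⟩
    · exact inl_mul_pathWord_ne hx.ne_one (hx.shift r).ne_one k (fun h => h1 (by simp [h])) h
    · exact inr_mul_pathWord_ne hx.ne_one (hx.shift r).ne_one k (fun h => h1 (by simp [h])) h

end CyclicReduction

section Holonomy

variable {A B Q W : Type*} [Group A] [Group B] [Group Q] [Group W]

/-- The homomorphism to the wreath product which sends `a ∈ A` to `π a` and `b ∈ B` to the
conjugate of `π b` by the function `Y`. -/
def wreathHom (π : Coprod A B →* Q) (Y : Q → W) : Coprod A B →* W ≀ᵣ Q :=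
  Coprod.lift ((RegularWreathProduct.inl.comp π).comp Coprod.inl)
    ((MulAut.conj (⟨fun r => Y r⁻¹, 1⟩ : W ≀ᵣ Q)⁻¹).toMonoidHom.comp
      ((RegularWreathProduct.inl.comp π).comp Coprod.inr))

/-- The value at the vertex `r` of the function part of `wreathHom π Y g`. -/
def hol (π : Coprod A B →* Q) (Y : Q → W) (g : Coprod A B) (r : Q) : W :=
  (wreathHom π Y g).left r⁻¹

variable (π : Coprod A B →* Q) (Y : Q → W)

lemma right_wreathHom (g : Coprod A B) : (wreathHom π Y g).right = π g := by
  have h : RegularWreathProduct.rightHom.comp (wreathHom π Y) = π := by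
    ext x
    · simp [wreathHom]
    · simp [wreathHom]
  exact DFunLike.congr_fun h g

lemma hol_mul (g g' : Coprod A B) (r : Q) :
    hol π Y (g * g') r = hol π Y g r * hol π Y g' (r * π g) := by
  simp [hol, right_wreathHom]

lemma hol_one (r : Q) : hol π Y 1 r = 1 := by simp [hol]

lemma hol_inl (a : A) (r : Q) : hol π Y (Coprod.inl a) r = 1 := by
  simp [hol, wreathHom]

lemma hol_inr (b : B) (r : Q) :
    hol π Y (Coprod.inr b) r = (Y r)⁻¹ * Y (r * π (Coprod.inr b)) := by
  simp [hol, wreathHom]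

lemma hol_pow {g : Coprod A B} (hg : π g = 1) (k : ℕ) (r : Q) :
    hol π Y (g ^ k) r = hol π Y g r ^ k := by
  induction k with
  | zero => simp [hol_one]
  | succ k ih => rw [pow_succ, hol_mul, ih, map_pow, hg, one_pow, mul_one, pow_succ]

lemma wreathHom_eq_one_iff {g : Coprod A B} :
    wreathHom π Y g = 1 ↔ π g = 1 ∧ ∀ r, hol π Y g r = 1 := by
  rw [RegularWreathProduct.ext_iff, right_wreathHom, and_comm]
  refine and_congr Iff.rfl ⟨fun h r => by simp [hol, h], fun h => funext fun r => ?_⟩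
  simpa [hol] using h r⁻¹

lemma hol_pathWord_succ (x : ℕ → A × B) (s : ℕ) (r : Q) :
    hol π Y (pathWord x (s + 1)) r = hol π Y (pathWord x s) r *
      ((Y (r * π (pathWord x s) * π (Coprod.inl (x s).1)))⁻¹ *
        Y (r * π (pathWord x (s + 1)))) := by
  simp only [pathWord_succ, hol_mul, hol_inl, hol_inr, one_mul, map_mul, mul_assoc]

end Holonomy

section Good

variable {A B : Type*} [Group A] [Group B]

/-- A normal subgroup of finite index in `A ∗ B`, contained in the Cartesian subgroup with
quotient a `p`-group. -/
structure IsPGood (p : ℕ) (N : Subgroup (Coprod A B)) : Prop where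
  normal : N.Normal
  le : N ≤ cartesianSubgroup A B
  finite : Finite (Coprod A B ⧸ N)
  pow_mem : ∀ g ∈ cartesianSubgroup A B, ∃ t, g ^ p ^ t ∈ N

lemma isPGood_cartesianSubgroup (p : ℕ) [Finite A] [Finite B] :
    IsPGood p (cartesianSubgroup A B) where
  normal := inferInstance
  le := le_rfl
  finite := Finite.of_injective _ (QuotientGroup.kerLift_injective
    (Coprod.toProd : Coprod A B →* A × B))
  pow_mem g hg := ⟨0, by simpa using hg⟩

lemma IsPGood.inf {p : ℕ} {N M : Subgroup (Coprod A B)} (hN : IsPGood p N) (hM : IsPGood p M) :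
    IsPGood p (N ⊓ M) where
  normal := by
    have := hN.normal
    have := hM.normal
    infer_instance
  le := inf_le_left.trans hN.le
  finite := by
    have := hN.finite
    have := hM.finite
    have h1 : N.FiniteIndex := Subgroup.finiteIndex_of_finite_quotient
    have h2 : M.FiniteIndex := Subgroup.finiteIndex_of_finite_quotient
    infer_instance
  pow_mem g hg := by
    obtain ⟨s, hs⟩ := hN.pow_mem g hg
    obtain ⟨t, ht⟩ := hM.pow_mem g hg
    refine ⟨s + t, ?_, ?_⟩
    · rw [pow_add, pow_mul]
      exact Subgroup.pow_mem _ hs _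
    · rw [pow_add, mul_comm, pow_mul]
      exact Subgroup.pow_mem _ ht _

lemma IsPGood.ker_wreathHom {Q W : Type*} [Group Q] [Group W] [Finite Q] [Finite W] {p s : ℕ}
    (hW : ∀ w : W, w ^ p ^ s = 1) {π : Coprod A B →* Q} (hπ : IsPGood p π.ker) (Y : Q → W) :
    IsPGood p (wreathHom π Y).ker where
  normal := inferInstance
  le := fun g hg => hπ.le ((wreathHom_eq_one_iff π Y).1 hg).1
  finite := Finite.of_injective _ (QuotientGroup.kerLift_injective (wreathHom π Y))
  pow_mem g hg := by
    obtain ⟨t, ht⟩ := hπ.pow_mem g hg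
    refine ⟨t + s, (wreathHom_eq_one_iff π Y).2 ⟨?_, fun r => ?_⟩⟩
    · rw [pow_add, pow_mul, map_pow, MonoidHom.mem_ker.1 ht, one_pow]
    · rw [pow_add, pow_mul, hol_pow π Y ht, hW]

lemma IsPGood.exists_orderOf_eq {p : ℕ} (hp : p.Prime) {Q : Type*} [Group Q]
    {π : Coprod A B →* Q} (hπ : IsPGood p π.ker) {g : Coprod A B}
    (hg : g ∈ cartesianSubgroup A B) : ∃ t, orderOf (π g) = p ^ t := by
  obtain ⟨t, ht⟩ := hπ.pow_mem g hg
  obtain ⟨k, -, hk⟩ := (Nat.dvd_prime_pow hp).1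
    (orderOf_dvd_of_pow_eq_one (x := π g) (n := p ^ t) (by rwa [← map_pow]))
  exact ⟨k, hk⟩

/-- Letters are determined by their images in the quotient by a subgroup of `C`. -/
lemma inl_eq_of_map_eq {Q : Type*} [Group Q] {π : Coprod A B →* Q}
    (hπ : π.ker ≤ cartesianSubgroup A B) {a a' : A}
    (h : π (Coprod.inl a) = π (Coprod.inl a')) : a = a' := by
  have := hπ ((MonoidHom.eq_iff π).1 h)
  simpa [mem_cartesianSubgroup, Prod.ext_iff, inv_mul_eq_one, eq_comm] using this

lemma inr_eq_of_map_eq {Q : Type*} [Group Q] {π : Coprod A B →* Q}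
    (hπ : π.ker ≤ cartesianSubgroup A B) {b b' : B}
    (h : π (Coprod.inr b) = π (Coprod.inr b')) : b = b' := by
  have := hπ ((MonoidHom.eq_iff π).1 h)
  simpa [mem_cartesianSubgroup, Prod.ext_iff, inv_mul_eq_one, eq_comm] using this

lemma isLetter_eq_one_of_map_eq_one {Q : Type*} [Group Q] {π : Coprod A B →* Q}
    (hπ : π.ker ≤ cartesianSubgroup A B) {β : Coprod A B} (hβ : IsLetter β) (h : π β = 1) :
    β = 1 := by
  rcases hβ with ⟨a, rfl⟩ | ⟨b, rfl⟩
  · rw [(inl_eq_of_map_eq hπ (by simpa using h) : a = 1), map_one]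
  · rw [(inr_eq_of_map_eq hπ (by simpa using h) : b = 1), map_one]

end Good

section Unitriangular

variable (p d : ℕ)

/-- Square matrices of size `d + 1` over `ℤ/pℤ`. -/
abbrev SqMatrix := Matrix (Fin (d + 1)) (Fin (d + 1)) (ZMod p)

variable [Fact p.Prime]

/-- Matrices whose entries vanish below the `k`-th superdiagonal. -/
def upperMatrix (k : ℕ) : AddSubgroup (SqMatrix p d) where
  carrier := {M | ∀ i j : Fin (d + 1), (j : ℕ) < i + k → M i j = 0}
  zero_mem' := by simp
  add_mem' := by
    intro M L hM hL i j h
    simp [hM i j h, hL i j h]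
  neg_mem' := by
    intro M hM i j h
    simp [hM i j h]

variable {p d}

lemma mul_mem_upperMatrix {k l : ℕ} {M L : SqMatrix p d}
    (hM : M ∈ upperMatrix p d k) (hL : L ∈ upperMatrix p d l) :
    M * L ∈ upperMatrix p d (k + l) := by
  intro i j h
  rw [Matrix.mul_apply]
  refine Finset.sum_eq_zero fun m _ => ?_
  by_cases hm : (m : ℕ) < i + k
  · rw [hM i m hm, zero_mul]
  · rw [hL m j (by omega), mul_zero]

lemma upperMatrix_anti {k l : ℕ} (h : k ≤ l) : upperMatrix p d l ≤ upperMatrix p d k :=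
  fun _ hM i j hij => hM i j (by omega)

lemma one_mem_upperMatrix : (1 : Matrix _ _ _) ∈ upperMatrix p d 0 := by
  intro i j h
  exact Matrix.one_apply_ne (by rintro rfl; omega)

lemma pow_mem_upperMatrix {M : SqMatrix p d}
    (hM : M ∈ upperMatrix p d 1) (k : ℕ) : M ^ k ∈ upperMatrix p d k := by
  induction k with
  | zero => exact one_mem_upperMatrix
  | succ k ih => exact mul_mem_upperMatrix ih hM

lemma eq_zero_of_mem_upperMatrix {k : ℕ} (hk : d < k)
    {M : SqMatrix p d} (hM : M ∈ upperMatrix p d k) : M = 0 := by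
  ext i j
  exact hM i j (by omega)

variable (p d)

/-- The monoid of upper unitriangular matrices. -/
def unitriMonoid : Submonoid (SqMatrix p d) where
  carrier := {M | M - 1 ∈ upperMatrix p d 1}
  one_mem' := by simp
  mul_mem' := by
    intro M L hM hL
    have h : M * L - 1 = (M - 1) * (L - 1) + (M - 1) + (L - 1) := by noncomm_ring
    rw [Set.mem_ofPred_eq] at *
    rw [h]
    exact add_mem (add_mem (upperMatrix_anti (by omega) (mul_mem_upperMatrix hM hL)) hM) hL

/-- The group of upper unitriangular matrices. -/
abbrev Unitri := (unitriMonoid p d).units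

variable {p d}

instance : Finite (Unitri p d) := inferInstance

lemma unitri_sub_one_mem (w : Unitri p d) : (w.1.val - 1) ∈ upperMatrix p d 1 :=
  (Submonoid.mem_units_iff _ _).1 w.2 |>.1

lemma pow_prime_pow_sub_one (M : SqMatrix p d) (k : ℕ) :
    M ^ p ^ k - 1 = (M - 1) ^ p ^ k := by
  rw [sub_pow_char_pow_of_commute p k (Commute.one_right M), one_pow]

lemma pow_eq_one_of_mem_unitriMonoid {M : SqMatrix p d}
    (hM : M ∈ unitriMonoid p d) : M ^ p ^ d = 1 := by
  rw [← sub_eq_zero, pow_prime_pow_sub_one]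
  exact eq_zero_of_mem_upperMatrix (Nat.lt_pow_self (Fact.out : p.Prime).one_lt)
    (pow_mem_upperMatrix hM _)

lemma unitri_pow_eq_one (w : Unitri p d) : w ^ p ^ d = 1 := by
  ext : 2
  simpa using pow_eq_one_of_mem_unitriMonoid (M := w.1.val) (unitri_sub_one_mem w)

/-- The matrix with prescribed entries on the first superdiagonal, and zeros elsewhere. -/
def superDiag (c : ℕ → ZMod p) : SqMatrix p d :=
  Matrix.of fun i j => if (j : ℕ) = i + 1 then c i else 0

lemma superDiag_mem (c : ℕ → ZMod p) : (superDiag c : SqMatrix p d) ∈ upperMatrix p d 1 := by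
  intro i j h
  exact if_neg (by omega)

lemma mul_superDiag_succ (M : SqMatrix p d) (c : ℕ → ZMod p)
    (i : Fin (d + 1)) {j : ℕ} (hj : j + 1 < d + 1) :
    (M * superDiag c : SqMatrix p d) i ⟨j + 1, hj⟩ = M i ⟨j, by omega⟩ * c j := by
  rw [Matrix.mul_apply, Finset.sum_eq_single ⟨j, by omega⟩]
  · simp [superDiag]
  · intro m _ hm
    have : ¬ j + 1 = (m : ℕ) + 1 := fun h => hm (Fin.ext (by simp; omega))
    simp only [superDiag, Matrix.of_apply, if_neg this, mul_zero]
  · simp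

lemma superDiag_mul_self {c : ℕ → ZMod p} (hc : ∀ j, c j * c (j + 1) = 0) :
    (superDiag c * superDiag c : SqMatrix p d) = 0 := by
  ext i ⟨j, hj⟩
  rcases j with _ | j
  · exact mul_mem_upperMatrix (superDiag_mem c) (superDiag_mem c) i ⟨0, hj⟩ (by simp)
  · rw [mul_superDiag_succ]
    simp only [superDiag, Matrix.of_apply, Matrix.zero_apply]
    split_ifs with h
    · rw [h, hc]
    · rw [zero_mul]

lemma one_add_superDiag_mem (c : ℕ → ZMod p) :
    (1 + superDiag c : SqMatrix p d) ∈ unitriMonoid p d := by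
  change _ - 1 ∈ upperMatrix p d 1
  simpa using superDiag_mem c

/-- The unitriangular matrix with prescribed first superdiagonal, and zeros above it. -/
def unitriOf (c : ℕ → ZMod p) : Unitri p d :=
  ⟨Units.ofPowEqOne (1 + superDiag c) (p ^ d)
      (pow_eq_one_of_mem_unitriMonoid (one_add_superDiag_mem c))
      (pow_ne_zero _ (Fact.out : p.Prime).ne_zero), by
    refine (Submonoid.mem_units_iff _ _).2 ⟨one_add_superDiag_mem c, ?_⟩
    simpa using pow_mem (one_add_superDiag_mem (d := d) c) (p ^ d - 1)⟩

lemma val_unitriOf (c : ℕ → ZMod p) :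
    (unitriOf c : Unitri p d).1.val = 1 + superDiag c := rfl

lemma val_inv_unitriOf {c : ℕ → ZMod p} (hc : ∀ j, c j * c (j + 1) = 0) :
    ((unitriOf c)⁻¹ : Unitri p d).1.val = 1 - superDiag c := by
  rw [Subgroup.coe_inv, Units.inv_eq_of_mul_eq_one_left]
  rw [val_unitriOf, sub_mul, mul_add (superDiag c), superDiag_mul_self hc]
  simp

/-- The entry in position `(j, j + 1)`, or zero if there is no such position. -/
def diagEntry (w : Unitri p d) (j : ℕ) : ZMod p :=
  if h : j < d then w.1.val ⟨j, by omega⟩ ⟨j + 1, by omega⟩ else 0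

lemma diagEntry_mul (w w' : Unitri p d) (j : ℕ) :
    diagEntry (w * w') j = diagEntry w j + diagEntry w' j := by
  unfold diagEntry
  split_ifs with h
  · have h2 := mul_mem_upperMatrix (unitri_sub_one_mem w) (unitri_sub_one_mem w')
      ⟨j, by omega⟩ ⟨j + 1, by omega⟩ (by simp)
    have h1 : (1 : SqMatrix p d) ⟨j, by omega⟩ ⟨j + 1, by omega⟩ = 0 :=
      Matrix.one_apply_ne (by simp)
    rw [show (w.1.val - 1) * (w'.1.val - 1) = (w * w').1.val - w.1.val - w'.1.val + 1 by
      simp only [Subgroup.coe_mul, Units.val_mul]; noncomm_ring] at h2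
    simp only [Matrix.add_apply, Matrix.sub_apply, h1] at h2
    linear_combination h2
  · simp

lemma diagEntry_one (j : ℕ) : diagEntry (1 : Unitri p d) j = 0 := by
  simpa using diagEntry_mul (1 : Unitri p d) 1 j

lemma diagEntry_inv (w : Unitri p d) (j : ℕ) : diagEntry w⁻¹ j = - diagEntry w j := by
  rw [eq_neg_iff_add_eq_zero, ← diagEntry_mul, inv_mul_cancel, diagEntry_one]

lemma diagEntry_unitriOf (c : ℕ → ZMod p) {j : ℕ} (hj : j < d) :
    diagEntry (unitriOf c : Unitri p d) j = c j := by
  rw [diagEntry, dif_pos hj, val_unitriOf, Matrix.add_apply,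
    Matrix.one_apply_ne (by simp), zero_add]
  simp [superDiag]

lemma unitri_sub_one_pow_apply (w : Unitri p d) {s : ℕ} (hs : s < d + 1) :
    ((w.1.val - 1) ^ s) 0 ⟨s, hs⟩ = ∏ j ∈ Finset.range s, diagEntry w j := by
  induction s with
  | zero => simp
  | succ s ih =>
    rw [pow_succ, Matrix.mul_apply, Finset.prod_range_succ, ← ih (by omega),
      Finset.sum_eq_single ⟨s, by omega⟩]
    · rw [diagEntry, dif_pos (by omega), Matrix.sub_apply, Matrix.one_apply_ne (by simp), sub_zero]
    · intro m _ hm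
      have hm' : (m : ℕ) ≠ s := fun h => hm (Fin.ext h)
      by_cases h : (m : ℕ) < s
      · rw [pow_mem_upperMatrix (unitri_sub_one_mem w) s 0 m (by simpa using h), zero_mul]
      · rw [(unitri_sub_one_mem w) m ⟨s + 1, hs⟩ (by simp; omega), mul_zero]
    · simp

lemma unitri_pow_eq_one_iff {k : ℕ} (w : Unitri p (p ^ k)) :
    w ^ p ^ k = 1 ↔ ∏ j ∈ Finset.range (p ^ k), diagEntry w j = 0 := by
  rw [← unitri_sub_one_pow_apply w (Nat.lt_succ_self _)]
  have h : w ^ p ^ k = 1 ↔ (w.1.val - 1) ^ p ^ k = 0 := by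
    rw [← pow_prime_pow_sub_one, sub_eq_zero, Subtype.ext_iff, Units.ext_iff]
    simp
  rw [h]
  refine ⟨fun h => by rw [h]; rfl, fun h0 => ?_⟩
  ext i j
  by_cases hij : (j : ℕ) < i + p ^ k
  · exact pow_mem_upperMatrix (unitri_sub_one_mem w) _ i j hij
  · obtain rfl : i = 0 := Fin.ext (by rw [Fin.val_zero]; omega)
    obtain rfl : j = ⟨p ^ k, Nat.lt_succ_self _⟩ := Fin.ext (by simp at hij ⊢; omega)
    exact h0

end Unitriangular

section Residual

variable {p d : ℕ} [Fact p.Prime]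

lemma row_mul_one_add_superDiag {M : SqMatrix p d} {t : ℕ}
    (hM : ∀ j : Fin (d + 1), t < (j : ℕ) → M 0 j = 0) (ε : ZMod p) (c : ℕ → ZMod p) :
    (∀ j : Fin (d + 1), t + 1 < (j : ℕ) → (M * (1 + ε • superDiag c) : SqMatrix p d) 0 j = 0) ∧
      ∀ (h : t < d), (M * (1 + ε • superDiag c) : SqMatrix p d) 0 ⟨t + 1, by omega⟩ =
        ε * (M 0 ⟨t, by omega⟩ * c t) := by
  have key : ∀ (j : ℕ) (hj : j + 1 < d + 1),
      (M * (1 + ε • superDiag c) : SqMatrix p d) 0 ⟨j + 1, hj⟩ = M 0 ⟨j + 1, hj⟩ + ε * (M 0 ⟨j, by omega⟩ * c j) := by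
    intro j hj
    rw [mul_add, mul_one, Matrix.add_apply, mul_smul_comm, Matrix.smul_apply,
      mul_superDiag_succ, smul_eq_mul]
  constructor
  · rintro ⟨_ | j, hj⟩ hjt
    · simp at hjt
    · simp only [add_lt_add_iff_right] at hjt
      rw [key, hM _ (by simp; omega), hM _ hjt]
      simp
  · intro h
    rw [key, hM _ (by simp), zero_add]

variable {A B : Type*} [Group A] [Group B] [Finite A] [Finite B]

lemma exists_isPGood_pathWord_notMem (p : ℕ) [Fact p.Prime] {x : ℕ → A × B} {n : ℕ} (hn : 0 < n)
    (hx : ∀ i, (x i).1 ≠ 1 ∧ (x i).2 ≠ 1) :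
    ∃ N : Subgroup (Coprod A B), IsPGood p N ∧ pathWord x n ∉ N := by
  classical
  let π : Coprod A B →* A × B := Coprod.toProd
  have hπ : IsPGood p π.ker := isPGood_cartesianSubgroup p
  let r : ℕ → A × B := fun j => if Even j then π (pathWord x (j / 2)) * π (Coprod.inl (x (j / 2)).1)
    else π (pathWord x (j / 2 + 1))
  have hr0 : ∀ s, r (2 * s) = π (pathWord x s) * π (Coprod.inl (x s).1) := fun s => by simp [r]
  have hr1 : ∀ s, r (2 * s + 1) = π (pathWord x (s + 1)) := fun s => by
    have : (2 * s + 1) / 2 = s := by omega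
    simp [r, this, parity_simps]
  have hr : ∀ j, r j ≠ r (j + 1) := by
    intro j
    obtain ⟨s, rfl | rfl⟩ := j.even_or_odd'
    · rw [hr0, hr1, pathWord_succ, map_mul, map_mul, ← mul_assoc]
      intro h
      exact (hx s).2 (by simpa [π, Prod.ext_iff] using h)
    · rw [hr1, show 2 * s + 1 + 1 = 2 * (s + 1) by ring, hr0]
      intro h
      exact (hx (s + 1)).1 (by simpa [π, Prod.ext_iff] using h)
  let c : A × B → ℕ → ZMod p := fun v j => if r j = v then 1 else 0
  have hc : ∀ v j, c v j * c v (j + 1) = 0 := by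
    intro v j
    simp only [c]
    split_ifs with h1 h2
    · exact absurd (h1.trans h2.symm) (hr j)
    all_goals simp
  let Y : A × B → Unitri p (2 * n) := fun v => unitriOf (c v)
  have main : ∀ s (hs : s ≤ n),
      (∀ j : Fin (2 * n + 1), 2 * s < (j : ℕ) → (hol π Y (pathWord x s) 1).1.val 0 j = 0) ∧
        (hol π Y (pathWord x s) 1).1.val 0 ⟨2 * s, by omega⟩ = (-1) ^ s := by
    intro s
    induction s with
    | zero =>
      refine fun _ => ⟨fun j hj => ?_, ?_⟩
      · rw [pathWord_zero, hol_one]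
        exact Matrix.one_apply_ne (by rintro rfl; simp at hj)
      · rw [pathWord_zero, hol_one, pow_zero]
        exact Matrix.one_apply_eq 0
    | succ s ih =>
      intro hs
      obtain ⟨h1, h2⟩ := ih (by omega)
      have hval : (hol π Y (pathWord x (s + 1)) 1).1.val = (hol π Y (pathWord x s) 1).1.val *
          (1 + (-1 : ZMod p) • superDiag (c (r (2 * s)))) *
          (1 + (1 : ZMod p) • superDiag (c (r (2 * s + 1)))) := by
        rw [hol_pathWord_succ, one_mul, one_mul, ← hr0, ← hr1, Subgroup.coe_mul, Subgroup.coe_mul,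
          Units.val_mul, Units.val_mul, val_inv_unitriOf (hc _), val_unitriOf, mul_assoc]
        simp [sub_eq_add_neg]
      obtain ⟨h3, h4⟩ := row_mul_one_add_superDiag h1 (-1) (c (r (2 * s)))
      obtain ⟨h5, h6⟩ := row_mul_one_add_superDiag h3 1 (c (r (2 * s + 1)))
      rw [hval]
      refine ⟨fun j hj => h5 j (by omega), ?_⟩
      have h6' := h6 (by omega)
      rw [h4 (by omega), h2] at h6'
      refine h6'.trans ?_
      simp [c, pow_succ']
  refine ⟨(wreathHom π Y).ker, hπ.ker_wreathHom unitri_pow_eq_one Y, fun hmem => ?_⟩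
  have h0 := (main n le_rfl).2
  rw [((wreathHom_eq_one_iff π Y).1 hmem).2 1] at h0
  have h1 : (1 : SqMatrix p (2 * n)) 0 ⟨2 * n, by omega⟩ = 0 :=
    Matrix.one_apply_ne (by rw [Ne, Fin.ext_iff]; simp; omega)
  exact pow_ne_zero n (neg_ne_zero.2 one_ne_zero) (h0.symm.trans h1)

lemma exists_isPGood_notMem (p : ℕ) [Fact p.Prime] {g : Coprod A B} (hg : g ≠ 1) :
    ∃ N : Subgroup (Coprod A B), IsPGood p N ∧ g ∉ N := by
  by_cases hC : g ∈ cartesianSubgroup A B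
  · obtain ⟨h, x, n, hn, hx, -, rfl⟩ := exists_conj_pathWord hC hg
    obtain ⟨N, hN, hxN⟩ := exists_isPGood_pathWord_notMem p hn hx
    refine ⟨N, hN, fun hmem => hxN ?_⟩
    have := hN.normal.conj_mem _ hmem h⁻¹
    rwa [show h⁻¹ * (h * pathWord x n * h⁻¹) * h⁻¹⁻¹ = pathWord x n by group] at this
  · exact ⟨_, isPGood_cartesianSubgroup p, hC⟩

lemma exists_isPGood_forall_notMem (p : ℕ) [Fact p.Prime] {S : Set (Coprod A B)} (hS : S.Finite)
    (h1 : 1 ∉ S) : ∃ N : Subgroup (Coprod A B), IsPGood p N ∧ ∀ g ∈ S, g ∉ N := by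
  induction S, hS using Set.Finite.induction_on with
  | empty => exact ⟨_, isPGood_cartesianSubgroup p, by simp⟩
  | @insert a S _ _ ih =>
    simp only [Set.mem_insert_iff, not_or] at h1
    obtain ⟨N, hN, hNS⟩ := ih h1.2
    obtain ⟨M, hM, haM⟩ := exists_isPGood_notMem p (Ne.symm h1.1)
    refine ⟨N ⊓ M, hN.inf hM, ?_⟩
    rintro g (rfl | hg) ⟨hgN, hgM⟩
    · exact haM hgM
    · exact hNS g hg hgN

end Residual

section Loops

variable {A B : Type*} [Group A] [Group B] {Q : Type*} [Group Q]

lemma IsLetter.inv {β : Coprod A B} (hβ : IsLetter β) : IsLetter β⁻¹ := by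
  rcases hβ with ⟨a, rfl⟩ | ⟨b, rfl⟩
  · exact Or.inl ⟨a⁻¹, by simp⟩
  · exact Or.inr ⟨b⁻¹, by simp⟩

lemma isLetter_one : IsLetter (1 : Coprod A B) := Or.inl ⟨1, by simp⟩

lemma isLetter_inl (a : A) : IsLetter (Coprod.inl a : Coprod A B) := Or.inl ⟨a, rfl⟩

lemma isLetter_inr (b : B) : IsLetter (Coprod.inr b : Coprod A B) := Or.inr ⟨b, rfl⟩

/-- The path `x` becomes in the quotient by `π` a closed path of length `T` none of whose letters
can be shortcut. -/
structure IsSimpleLoop (π : Coprod A B →* Q) (x : ℕ → A × B) (n T : ℕ) : Prop where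
  primitive : IsPrimitivePath x n
  ker_le : π.ker ≤ cartesianSubgroup A B
  dvd : n ∣ T
  pos : 0 < T
  map_add : ∀ s, π (pathWord x (s + T)) = π (pathWord x s)
  modEq : ∀ s t β, IsLetter β → π (pathWord x s) * π β = π (pathWord x t) → s ≡ t [MOD T]

lemma isSimpleLoop_of_not_commute [Finite Q] {π : Coprod A B →* Q} {x : ℕ → A × B} {n : ℕ}
    (hx : IsPrimitivePath x n) (hπ : π.ker ≤ cartesianSubgroup A B)
    (hsep : ∀ s r β, 0 < r → r < n → IsLetter β →
      pathWord (fun i => x (s + i)) r * β ∈ cartesianSubgroup A B →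
      ¬ Commute (π (pathWord (fun i => x (s + i)) r * β)) (π (pathWord (fun i => x (s + i)) n))) :
    IsSimpleLoop π x n (orderOf (π (pathWord x n)) * n) where
  primitive := hx
  ker_le := hπ
  dvd := dvd_mul_left _ _
  pos := Nat.mul_pos (orderOf_pos _) hx.pos
  map_add s := by
    rw [add_comm, Periodic.pathWord_mul hx.periodic, map_mul, map_pow, pow_orderOf_eq_one, one_mul]
  modEq := by
    have key : ∀ s l β, IsLetter β → π β = π (pathWord (fun i => x (s + i)) l) →
        orderOf (π (pathWord x n)) * n ∣ l := by
      intro s l β hβ h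
      have hs := hx.shift s
      have hl := Periodic.pathWord_mul hs.periodic (l / n) (l % n)
      rw [Nat.div_add_mod'] at hl
      set Z := pathWord (fun i => x (s + i)) n
      have hker : Z ^ (l / n) * (pathWord (fun i => x (s + i)) (l % n) * β⁻¹) ∈ π.ker := by
        rw [← mul_assoc, ← hl, MonoidHom.mem_ker, map_mul, ← h, map_inv, mul_inv_cancel]
      have hy := (Subgroup.mul_mem_cancel_left _ (Subgroup.pow_mem _ hs.mem _)).1 (hπ hker)
      rcases Nat.eq_zero_or_pos (l % n) with h0 | h0
      · rw [h0, pathWord_zero, one_mul] at hy hker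
        have hβ1 : β⁻¹ = 1 := isLetter_eq_one_of_map_eq_one
          (π := (Coprod.toProd : Coprod A B →* A × B)) le_rfl hβ.inv hy
        rw [hβ1, mul_one, MonoidHom.mem_ker, map_pow] at hker
        have hconj : π (pathWord x n) = π (pathWord x s) * π Z * (π (pathWord x s))⁻¹ := by
          rw [eq_mul_inv_iff_mul_eq, ← map_mul, ← map_mul,
            pathWord_mul_pathWord_shift hx.periodic]
        have hdvd : orderOf (π (pathWord x n)) ∣ l / n := by
          refine orderOf_dvd_of_pow_eq_one ?_
          rw [hconj, conj_pow, hker]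
          group
        calc _ ∣ l / n * n := Nat.mul_dvd_mul_right hdvd n
          _ = l := Nat.div_mul_cancel (Nat.dvd_of_mod_eq_zero h0)
      · refine absurd ?_ (hsep s (l % n) β⁻¹ h0 (Nat.mod_lt _ hx.pos) hβ.inv hy)
        rw [MonoidHom.mem_ker, map_mul, map_pow, ← eq_inv_iff_mul_eq_one,
          eq_comm, inv_eq_iff_eq_inv] at hker
        rw [hker]
        exact ((Commute.refl _).pow_left _).inv_left
    have key' : ∀ s t β, s ≤ t → IsLetter β → π (pathWord x s) * π β = π (pathWord x t) →
        s ≡ t [MOD orderOf (π (pathWord x n)) * n] := by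
      intro s t β hst hβ h
      rw [← Nat.add_sub_cancel' hst, pathWord_add, map_mul, mul_right_inj] at h
      exact (Nat.modEq_iff_dvd' hst).2 (key s _ β hβ h)
    intro s t β hβ h
    rcases le_total s t with hst | hst
    · exact key' s t β hst hβ h
    · exact (key' t s β⁻¹ hst hβ.inv (by rw [← h, map_inv, mul_inv_cancel_right])).symm

lemma exists_finite_isSimpleLoop [Finite A] [Finite B]
    {x : ℕ → A × B} {n : ℕ} (hx : IsPrimitivePath x n) :
    ∃ S : Set (Coprod A B), S.Finite ∧ 1 ∉ S ∧ ∀ (Q : Type*) [Group Q] [Finite Q]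
      (π : Coprod A B →* Q), π.ker ≤ cartesianSubgroup A B → (∀ g ∈ S, π g ≠ 1) →
      IsSimpleLoop π x n (orderOf (π (pathWord x n)) * n) := by
  let f : ℕ → ℕ → Coprod A B → Coprod A B := fun s r β =>
    pathWord (fun i => x (s + i)) r * β * pathWord (fun i => x (s + i)) n *
      (pathWord (fun i => x (s + i)) r * β)⁻¹ * (pathWord (fun i => x (s + i)) n)⁻¹
  let S : Set (Coprod A B) := ⋃ s ∈ Set.Iio n, ⋃ r ∈ Set.Ioo 0 n, f s r ''
    {β | IsLetter β ∧ pathWord (fun i => x (s + i)) r * β ∈ cartesianSubgroup A B}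
  have hfin : {β : Coprod A B | IsLetter β}.Finite := by
    have h : {β : Coprod A B | IsLetter β} = Set.range (Coprod.inl : A →* Coprod A B) ∪
        Set.range (Coprod.inr : B →* Coprod A B) := by
      ext β
      simp [IsLetter, eq_comm]
    rw [h]
    exact (Set.finite_range _).union (Set.finite_range _)
  refine ⟨S, ?_, ?_, ?_⟩
  · refine (Set.finite_Iio n).biUnion fun s _ => (Set.finite_Ioo 0 n).biUnion fun r _ => ?_
    exact (hfin.subset fun β hβ => hβ.1).image _
  · simp only [S, Set.mem_iUnion, Set.mem_image, not_exists, not_and]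
    rintro s - r ⟨h0, hr⟩ β ⟨hβ, hC⟩ h
    exact (hx.shift s).not_commute h0 hr hβ hC (mul_inv_eq_iff_eq_mul.1 (mul_inv_eq_one.1 h))
  · intro Q _ _ π hπ hS
    refine isSimpleLoop_of_not_commute hx hπ fun s r β h0 hr hβ hC hcomm => ?_
    have hmod : (fun i => x (s + i)) = fun i => x (s % n + i) := by
      funext i
      rw [← hx.periodic.map_mod_nat, ← hx.periodic.map_mod_nat (s % n + i), Nat.mod_add_mod]
    rw [hmod] at hC hcomm
    refine hS (f (s % n) r β) ?_ ?_
    · simp only [S, Set.mem_iUnion]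
      exact ⟨s % n, Nat.mod_lt _ hx.pos, r, ⟨h0, hr⟩, β, ⟨hβ, hC⟩, rfl⟩
    · simp only [f]
      rw [map_mul, map_mul, map_mul π (_ * β), hcomm.eq, map_inv, map_inv, mul_inv_cancel_right,
        mul_inv_cancel]

namespace IsSimpleLoop

variable {π : Coprod A B →* Q} {x y : ℕ → A × B} {n n' T T' : ℕ}

lemma map_eq_of_modEq (hx : IsSimpleLoop π x n T) {s t : ℕ} (h : s ≡ t [MOD T]) :
    π (pathWord x s) = π (pathWord x t) := by
  have hper : Function.Periodic (fun s => π (pathWord x s)) T := hx.map_add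
  have h1 := hper.map_mod_nat s
  rw [h] at h1
  exact h1.symm.trans (hper.map_mod_nat t)

lemma eq_of_modEq (hx : IsSimpleLoop π x n T) {s t : ℕ} (h : s ≡ t [MOD T]) : x s = x t := by
  have h' : s % n = t % n := h.of_dvd hx.dvd
  rw [← hx.primitive.periodic.map_mod_nat, h', hx.primitive.periodic.map_mod_nat]

lemma ne_mul_inl (hx : IsSimpleLoop π x n T) (s t : ℕ) :
    π (pathWord x s) ≠ π (pathWord x t) * π (Coprod.inl (x t).1) := by
  intro h
  have hmod := hx.modEq t s _ (isLetter_inl _) h.symm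
  rw [hx.map_eq_of_modEq hmod, left_eq_mul] at h
  exact (hx.primitive.ne_one t).1 (inl_eq_of_map_eq hx.ker_le (by simpa using h))

lemma modEq_of_mul_inl_eq (hx : IsSimpleLoop π x n T) {s t : ℕ}
    (h : π (pathWord x s) * π (Coprod.inl (x s).1) = π (pathWord x t) * π (Coprod.inl (x t).1)) :
    s ≡ t [MOD T] := by
  refine hx.modEq s t (Coprod.inl ((x s).1 * (x t).1⁻¹)) (isLetter_inl _) ?_
  rw [map_mul, map_mul, map_inv, map_inv, ← mul_assoc, h, mul_inv_cancel_right]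

lemma map_pathWord_succ (π : Coprod A B →* Q) (x : ℕ → A × B) (s : ℕ) :
    π (pathWord x (s + 1)) =
      π (pathWord x s) * π (Coprod.inl (x s).1) * π (Coprod.inr (x s).2) := by
  rw [pathWord_succ, map_mul, map_mul, mul_assoc]

/-- If two simple loops have the same vertices, then one is a shift of the other. -/
lemma eq_shift (hy : IsSimpleLoop π y n' T') (hker : π.ker ≤ cartesianSubgroup A B) {g : Q}
    (h0 : ∀ s, ∃ t, π (pathWord x s) = g * π (pathWord y t))
    (h1 : ∀ s, ∃ t, π (pathWord x s) * π (Coprod.inl (x s).1) =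
      g * (π (pathWord y t) * π (Coprod.inl (y t).1))) :
    ∃ t, ∀ s, x s = y (t + s) := by
  obtain ⟨t, ht⟩ := h0 0
  have step : ∀ s, π (pathWord x s) = g * π (pathWord y (t + s)) →
      x s = y (t + s) ∧ π (pathWord x (s + 1)) = g * π (pathWord y (t + (s + 1))) := by
    intro s hs
    obtain ⟨j, hj⟩ := h1 s
    rw [hs, mul_assoc, mul_right_inj] at hj
    have hmod : t + s ≡ j [MOD T'] := by
      refine hy.modEq _ _ (Coprod.inl ((x s).1 * (y j).1⁻¹)) (isLetter_inl _) ?_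
      rw [map_mul, map_mul, map_inv, map_inv, ← mul_assoc, hj, mul_inv_cancel_right]
    rw [← hy.map_eq_of_modEq hmod, ← hy.eq_of_modEq hmod, mul_right_inj] at hj
    have ha := inl_eq_of_map_eq hker hj
    obtain ⟨k, hk⟩ := h0 (s + 1)
    rw [map_pathWord_succ, hs, ha, mul_assoc, mul_assoc, mul_right_inj, ← mul_assoc] at hk
    have hnext : π (pathWord y (t + s)) * π (Coprod.inl (y (t + s)).1) =
        π (pathWord y (t + (s + 1))) * (π (Coprod.inr (y (t + s)).2))⁻¹ := by
      rw [← add_assoc, map_pathWord_succ, mul_inv_cancel_right]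
    have hmod' : t + (s + 1) ≡ k [MOD T'] := by
      refine hy.modEq _ _ (Coprod.inr ((y (t + s)).2⁻¹ * (x s).2)) (isLetter_inr _) ?_
      rw [map_mul, map_mul, map_inv, map_inv, ← mul_assoc, ← hnext, hk]
    rw [← hy.map_eq_of_modEq hmod', ← add_assoc, map_pathWord_succ, mul_right_inj] at hk
    have hb := inr_eq_of_map_eq hker hk
    refine ⟨Prod.ext ha hb, ?_⟩
    rw [map_pathWord_succ, hs, ha, hb, ← add_assoc, map_pathWord_succ]
    simp only [mul_assoc]
  have all : ∀ s, π (pathWord x s) = g * π (pathWord y (t + s)) := by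
    intro s
    induction s with
    | zero => exact ht
    | succ s ih => exact (step s ih).2
  exact ⟨t, fun s => (step s (all s)).1⟩

/-- If two simple loops have the same vertices with the two kinds of vertices exchanged, then
one is a shift of the inverse of the other. -/
lemma eq_reverse_shift (hy : IsSimpleLoop π y n' T') (hker : π.ker ≤ cartesianSubgroup A B) {g : Q}
    (h0 : ∀ s, ∃ t, π (pathWord x s) = g * (π (pathWord y t) * π (Coprod.inl (y t).1)))
    (h1 : ∀ s, ∃ t, π (pathWord x s) * π (Coprod.inl (x s).1) = g * π (pathWord y t)) (l : ℕ) :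
    ∃ t, l < t ∧ ∀ s ≤ l, x s = ((y (t - s)).1⁻¹, (y (t - s - 1)).2⁻¹) := by
  obtain ⟨t, ht, htl⟩ : ∃ t, π (pathWord x 0) = g * (π (pathWord y t) *
      π (Coprod.inl (y t).1)) ∧ l < t := by
    obtain ⟨t, ht⟩ := h0 0
    have hmod : t ≡ t + (l + 1) * T' [MOD T'] := by simp [Nat.ModEq]
    refine ⟨t + (l + 1) * T', ?_, ?_⟩
    · rw [ht, hy.map_eq_of_modEq hmod, hy.eq_of_modEq hmod]
    · have := Nat.le_mul_of_pos_right (l + 1) hy.pos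
      omega
  have step : ∀ s ≤ l, π (pathWord x s) = g * (π (pathWord y (t - s)) *
        π (Coprod.inl (y (t - s)).1)) →
      x s = ((y (t - s)).1⁻¹, (y (t - s - 1)).2⁻¹) ∧ π (pathWord x (s + 1)) =
        g * (π (pathWord y (t - (s + 1))) * π (Coprod.inl (y (t - (s + 1))).1)) := by
    intro s hsl hs
    obtain ⟨j, hj⟩ := h1 s
    rw [hs, mul_assoc, mul_right_inj, mul_assoc] at hj
    have hmod := hy.modEq (t - s) j (Coprod.inl ((y (t - s)).1 * (x s).1)) (isLetter_inl _)
      (by simpa using hj)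
    rw [← hy.map_eq_of_modEq hmod, mul_eq_left] at hj
    have ha : (x s).1 = (y (t - s)).1⁻¹ := by
      refine inl_eq_of_map_eq hker ?_
      rw [map_inv, map_inv]
      exact eq_inv_of_mul_eq_one_right hj
    have hs' : π (pathWord x s) * π (Coprod.inl (x s).1) = g * π (pathWord y (t - s)) := by
      rw [hs, ha, map_inv, map_inv, mul_assoc, mul_inv_cancel_right]
    obtain ⟨r, hr⟩ : ∃ r, t - s = r + 1 := ⟨t - s - 1, by omega⟩
    obtain ⟨k, hk⟩ := h0 (s + 1)
    have hk' := hk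
    rw [map_pathWord_succ, hs', hr, mul_assoc, mul_right_inj] at hk'
    have hmod' : r + 1 ≡ k + 1 [MOD T'] := by
      refine hy.modEq _ _ (Coprod.inr ((x s).2 * (y k).2)) (isLetter_inr _) ?_
      rw [map_mul, map_mul, ← mul_assoc, hk', map_pathWord_succ]
    replace hmod' := Nat.ModEq.add_right_cancel' 1 hmod'
    rw [← hy.map_eq_of_modEq hmod', ← hy.eq_of_modEq hmod', map_pathWord_succ, mul_assoc,
      mul_eq_left] at hk'
    rw [show t - (s + 1) = r by omega, show t - s - 1 = r by omega]
    refine ⟨Prod.ext ha (inr_eq_of_map_eq hker ?_), ?_⟩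
    · rw [map_inv, map_inv]
      exact eq_inv_of_mul_eq_one_right hk'
    · rw [hk, ← hy.map_eq_of_modEq hmod', ← hy.eq_of_modEq hmod']
  have all : ∀ s ≤ l, π (pathWord x s) = g * (π (pathWord y (t - s)) *
        π (Coprod.inl (y (t - s)).1)) := by
    intro s
    induction s with
    | zero => exact fun _ => ht
    | succ s ih => exact fun hs => (step s (by omega) (ih (by omega))).2
  exact ⟨t, htl, fun s hs => (step s hs (all s hs)).1⟩

end IsSimpleLoop

end Loops

section Conjugacy

variable {A B : Type*} [Group A] [Group B] {x y : ℕ → A × B} {n n' : ℕ}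

lemma IsPrimitivePath.exists_conj_of_eq_shift (hx : IsPrimitivePath x n)
    (hy : IsPrimitivePath y n') {t : ℕ} (h : ∀ s, x s = y (t + s)) :
    ∃ w, pathWord y n' = w * pathWord x n * w⁻¹ := by
  obtain rfl : x = fun s => y (t + s) := funext h
  have hs := hy.shift t
  obtain rfl : n = n' := le_antisymm (hx.le_of_periodic _ hs.pos hs.periodic hs.mem)
    (hs.le_of_periodic _ hx.pos hx.periodic hx.mem)
  refine ⟨pathWord y t, ?_⟩
  rw [eq_mul_inv_iff_mul_eq, pathWord_mul_pathWord_shift hy.periodic]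

lemma mul_pathWord_reverse {t l : ℕ} (htl : l < t)
    (h : ∀ s ≤ l, x s = ((y (t - s)).1⁻¹, (y (t - s - 1)).2⁻¹)) :
    pathWord y t * Coprod.inl (y t).1 * pathWord x l =
      pathWord y (t - l) * Coprod.inl (y (t - l)).1 := by
  induction l with
  | zero => simp
  | succ l ih =>
    obtain ⟨r, hr⟩ : ∃ r, t - l = r + 1 := ⟨t - l - 1, by omega⟩
    rw [pathWord_succ, ← mul_assoc, ih (by omega) fun s hs => h s (by omega), h l (by omega), hr,
      show t - (l + 1) = r by omega, Nat.add_sub_cancel, pathWord_succ]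
    simp [mul_assoc]

lemma IsPrimitivePath.le_of_eq_reverse_shift (hx : IsPrimitivePath x n)
    (hy : IsPrimitivePath y n')
    (h : ∀ l, ∃ t, l < t ∧ ∀ s ≤ l, x s = ((y (t - s)).1⁻¹, (y (t - s - 1)).2⁻¹)) :
    n ≤ n' ∧ ∃ w, pathWord y n' = w * (pathWord x n')⁻¹ * w⁻¹ := by
  have hconj : ∃ w, pathWord y n' = w * (pathWord x n')⁻¹ * w⁻¹ := by
    obtain ⟨t, htl, ht⟩ := h n'
    have h1 := mul_pathWord_reverse htl ht
    obtain ⟨r, rfl⟩ : ∃ r, t = 1 * n' + r := ⟨t - n', by omega⟩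
    rw [Periodic.pathWord_mul hy.periodic, one_mul, Nat.add_sub_cancel_left, pow_one,
      add_comm n', hy.periodic r] at h1
    refine ⟨pathWord y r * Coprod.inl (y r).1, ?_⟩
    rw [eq_mul_inv_iff_mul_eq, eq_mul_inv_iff_mul_eq]
    simpa only [mul_assoc] using h1
  refine ⟨hx.le_of_periodic n' hy.pos (fun s => ?_) ?_, hconj⟩
  · obtain ⟨t, htl, ht⟩ := h (s + n')
    rw [ht s (by omega), ht (s + n') le_rfl]
    have h1 := hy.periodic (t - (s + n'))
    have h2 := hy.periodic (t - (s + n') - 1)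
    rw [show t - (s + n') + n' = t - s by omega] at h1
    rw [show t - (s + n') - 1 + n' = t - s - 1 by omega] at h2
    rw [h1, h2]
  · obtain ⟨w, hw⟩ := hconj
    have := Subgroup.Normal.conj_mem inferInstance _ hy.mem w⁻¹
    rw [hw, show w⁻¹ * (w * (pathWord x n')⁻¹ * w⁻¹) * w⁻¹⁻¹ = (pathWord x n')⁻¹ by group] at this
    exact inv_mem_iff.1 this

end Conjugacy

section Chains

variable {A B : Type*} [Group A] [Group B] {Q : Type*} [Group Q]

/-- The alternating sum of the values of `c` at the vertices of a path of length `T` based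
at `g`. -/
def loopSum {R : Type*} [AddCommGroup R] (π : Coprod A B →* Q) (x : ℕ → A × B) (T : ℕ) (g : Q)
    (c : Q → R) : R :=
  ∑ s ∈ Finset.range T,
    (c (g * π (pathWord x s)) - c (g * (π (pathWord x s) * π (Coprod.inl (x s).1))))

variable {p : ℕ} [Fact p.Prime] {π : Coprod A B →* Q} {x y : ℕ → A × B} {n n' T T' : ℕ}

lemma sum_range_ite_modEq (hT : 0 < T) (s : ℕ) :
    ∑ i ∈ Finset.range T, (if i ≡ s [MOD T] then (1 : ZMod p) else 0) = 1 := by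
  rw [Finset.sum_eq_single (s % T), if_pos (Nat.mod_modEq s T)]
  · intro i hi h
    refine if_neg fun h' => h ?_
    rw [← Nat.mod_eq_of_lt (Finset.mem_range.1 hi)]
    exact h'
  · intro h
    exact absurd (Finset.mem_range.2 (Nat.mod_lt s hT)) h

open Classical in
/-- The multiplicity of the vertex `e` in a path, counted with alternating signs. -/
noncomputable def loopChain (p : ℕ) (π : Coprod A B →* Q) (x : ℕ → A × B) (T : ℕ) (g e : Q) :
    ZMod p :=
  loopSum π x T g fun v => if v = e then 1 else 0

lemma IsSimpleLoop.loopChain_vertex (hx : IsSimpleLoop π x n T) (g : Q) (s : ℕ) :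
    loopChain p π x T g (g * π (pathWord x s)) = 1 := by
  refine Eq.trans ?_ (sum_range_ite_modEq (p := p) hx.pos s)
  rw [loopChain, loopSum]
  refine Finset.sum_congr rfl fun i _ => ?_
  rw [if_neg (fun h => hx.ne_mul_inl s i (mul_left_cancel h).symm), sub_zero]
  by_cases h : i ≡ s [MOD T]
  · rw [if_pos h, if_pos (by rw [hx.map_eq_of_modEq h])]
  · refine (if_neg fun h' => h ?_).trans (if_neg h).symm
    exact hx.modEq i s 1 isLetter_one (by simpa using mul_left_cancel h')

lemma IsSimpleLoop.loopChain_vertex_mul_inl (hx : IsSimpleLoop π x n T) (g : Q) (s : ℕ) :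
    loopChain p π x T g (g * (π (pathWord x s) * π (Coprod.inl (x s).1))) = -1 := by
  refine Eq.trans ?_ (congrArg Neg.neg (sum_range_ite_modEq (p := p) hx.pos s))
  rw [loopChain, loopSum, ← Finset.sum_neg_distrib]
  refine Finset.sum_congr rfl fun i _ => ?_
  rw [if_neg (fun h => hx.ne_mul_inl i s (mul_left_cancel h)), zero_sub]
  by_cases h : i ≡ s [MOD T]
  · rw [if_pos h, if_pos (by rw [hx.map_eq_of_modEq h, hx.eq_of_modEq h])]
  · rw [if_neg h, if_neg fun h' => h (hx.modEq_of_mul_inl_eq (mul_left_cancel h'))]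

lemma loopChain_eq_zero {g e : Q} (h0 : ∀ s, g * π (pathWord x s) ≠ e)
    (h1 : ∀ s, g * (π (pathWord x s) * π (Coprod.inl (x s).1)) ≠ e) :
    loopChain p π x T g e = 0 := by
  rw [loopChain, loopSum]
  refine Finset.sum_eq_zero fun s _ => ?_
  rw [if_neg (h0 s), if_neg (h1 s), sub_zero]

lemma IsSimpleLoop.exists_of_loopChain_eq_one (hp : p ≠ 2) (hx : IsSimpleLoop π x n T) {g e : Q}
    (h : loopChain p π x T g e = 1) : ∃ s, e = g * π (pathWord x s) := by
  have : Fact (2 < p) := ⟨lt_of_le_of_ne (Fact.out : p.Prime).two_le hp.symm⟩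
  by_contra! h0
  by_cases h1 : ∃ s, e = g * (π (pathWord x s) * π (Coprod.inl (x s).1))
  · obtain ⟨s, rfl⟩ := h1
    rw [hx.loopChain_vertex_mul_inl] at h
    exact ZMod.neg_one_ne_one h
  · push Not at h1
    rw [loopChain_eq_zero (fun s => (h0 s).symm) fun s => (h1 s).symm] at h
    exact zero_ne_one h

lemma IsSimpleLoop.exists_of_loopChain_eq_neg_one (hp : p ≠ 2) (hx : IsSimpleLoop π x n T)
    {g e : Q} (h : loopChain p π x T g e = -1) :
    ∃ s, e = g * (π (pathWord x s) * π (Coprod.inl (x s).1)) := by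
  have : Fact (2 < p) := ⟨lt_of_le_of_ne (Fact.out : p.Prime).two_le hp.symm⟩
  by_contra! h1
  by_cases h0 : ∃ s, e = g * π (pathWord x s)
  · obtain ⟨s, rfl⟩ := h0
    rw [hx.loopChain_vertex] at h
    exact ZMod.neg_one_ne_one h.symm
  · push Not at h0
    rw [loopChain_eq_zero (fun s => (h0 s).symm) fun s => (h1 s).symm] at h
    exact zero_ne_one (neg_eq_zero.1 h.symm).symm

/-- Two simple loops with proportional chains represent conjugate elements, up to inversion. -/
lemma IsSimpleLoop.exists_conj_of_proportional (hp : p ≠ 2) (hx : IsSimpleLoop π x n T)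
    (hy : IsSimpleLoop π y n' T') {g : Q} {c : ZMod p}
    (h : ∀ e, loopChain p π x T 1 e = c * loopChain p π y T' g e) :
    ∃ w, pathWord y n' = w * pathWord x n * w⁻¹ ∨
      pathWord y n' = w * (pathWord x n)⁻¹ * w⁻¹ := by
  have hc : c = 1 ∨ c = -1 := by
    have h0 := h (1 * π (pathWord x 0))
    rw [hx.loopChain_vertex] at h0
    by_cases h1 : ∃ s, 1 * π (pathWord x 0) = g * π (pathWord y s)
    · obtain ⟨s, hs⟩ := h1
      rw [hs, hy.loopChain_vertex, mul_one] at h0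
      exact Or.inl h0.symm
    · by_cases h2 : ∃ s, 1 * π (pathWord x 0) =
          g * (π (pathWord y s) * π (Coprod.inl (y s).1))
      · obtain ⟨s, hs⟩ := h2
        rw [hs, hy.loopChain_vertex_mul_inl, mul_neg_one] at h0
        exact Or.inr (by rw [h0, neg_neg])
      · push Not at h1 h2
        rw [loopChain_eq_zero (fun s => (h1 s).symm) fun s => (h2 s).symm, mul_zero] at h0
        exact absurd h0 one_ne_zero
  rcases hc with rfl | rfl
  · obtain ⟨t, ht⟩ := hy.eq_shift (x := x) hx.ker_le (g := g)
      (fun s => hy.exists_of_loopChain_eq_one hp (by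
        rw [← one_mul (loopChain p π y _ _ _), ← h]
        simpa using hx.loopChain_vertex 1 s))
      (fun s => hy.exists_of_loopChain_eq_neg_one hp (by
        rw [← one_mul (loopChain p π y _ _ _), ← h]
        simpa using hx.loopChain_vertex_mul_inl 1 s))
    obtain ⟨w, hw⟩ := hx.primitive.exists_conj_of_eq_shift hy.primitive ht
    exact ⟨w, Or.inl hw⟩
  · have hxy := hy.eq_reverse_shift (x := x) hx.ker_le (g := g)
      (fun s => hy.exists_of_loopChain_eq_neg_one hp (by
        rw [← neg_inj, ← neg_one_mul, ← h, neg_neg]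
        simpa using hx.loopChain_vertex 1 s))
      (fun s => hy.exists_of_loopChain_eq_one hp (by
        rw [← neg_inj, ← neg_one_mul, ← h]
        simpa using hx.loopChain_vertex_mul_inl 1 s))
    have hyx := hx.eq_reverse_shift (x := y) hx.ker_le (g := g⁻¹)
      (fun s => by
        obtain ⟨t, ht⟩ := hx.exists_of_loopChain_eq_neg_one (p := p) hp
          (e := g * π (pathWord y s)) (g := 1) (by rw [h, hy.loopChain_vertex, mul_one])
        exact ⟨t, by rw [eq_inv_mul_iff_mul_eq, ht, one_mul]⟩)
      (fun s => by
        obtain ⟨t, ht⟩ := hx.exists_of_loopChain_eq_one (p := p) hp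
          (e := g * (π (pathWord y s) * π (Coprod.inl (y s).1))) (g := 1)
          (by rw [h, hy.loopChain_vertex_mul_inl, neg_one_mul, neg_neg])
        exact ⟨t, by rw [eq_inv_mul_iff_mul_eq, ht, one_mul]⟩)
    obtain ⟨h1, w, hw⟩ := hx.primitive.le_of_eq_reverse_shift hy.primitive hxy
    obtain rfl := le_antisymm h1 (hy.primitive.le_of_eq_reverse_shift hx.primitive hyx).1
    exact ⟨w, Or.inr hw⟩

lemma IsSimpleLoop.exists_loopSum_eq_zero (hp : p ≠ 2) (hx : IsSimpleLoop π x n T)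
    (hy : IsSimpleLoop π y n' T')
    (hconj : ¬ ∃ w, pathWord y n' = w * pathWord x n * w⁻¹ ∨
      pathWord y n' = w * (pathWord x n)⁻¹ * w⁻¹) (g : Q) :
    ∃ c : Q → ZMod p, loopSum π y T' g c = 0 ∧ loopSum π x T 1 c ≠ 0 := by
  classical
  by_contra! h
  refine hconj (hx.exists_conj_of_proportional (p := p) hp hy (g := g)
    (c := loopChain p π x T 1 (g * π (pathWord y 0))) fun e => ?_)
  have hlin : ∀ (z : ℕ → A × B) (S : ℕ) (k : Q) (a : ZMod p) (e e' : Q),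
      loopSum π z S k (fun v => (if v = e then 1 else 0) - a * (if v = e' then 1 else 0)) =
        loopChain p π z S k e - a * loopChain p π z S k e' := by
    intro z S k a e e'
    simp only [loopChain, loopSum, Finset.mul_sum, ← Finset.sum_sub_distrib]
    refine Finset.sum_congr rfl fun s _ => ?_
    ring
  have h1 := h _ ((hlin y T' g (loopChain p π y T' g e) e (g * π (pathWord y 0))).trans
    (by rw [hy.loopChain_vertex, mul_one, sub_self]))
  rw [hlin, sub_eq_zero] at h1
  rw [h1, mul_comm]

end Chains

section Splitting

variable {A B : Type*} [Group A] [Group B] {Q : Type*} [Group Q] {p : ℕ} [Fact p.Prime]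
  {π : Coprod A B →* Q} {x y : ℕ → A × B} {n n' T T' : ℕ}

lemma diagEntry_hol_pathWord {d : ℕ} (Y : Q → Unitri p d) (x : ℕ → A × B) (g : Q) (j s : ℕ) :
    diagEntry (hol π Y (pathWord x s) g) j = ∑ i ∈ Finset.range s,
      (diagEntry (Y (g * π (pathWord x (i + 1)))) j -
        diagEntry (Y (g * (π (pathWord x i) * π (Coprod.inl (x i).1)))) j) := by
  induction s with
  | zero => simp [hol_one, diagEntry_one]
  | succ s ih =>
    rw [hol_pathWord_succ, diagEntry_mul, diagEntry_mul, diagEntry_inv, ih,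
      Finset.sum_range_succ, mul_assoc g, neg_add_eq_sub]

lemma diagEntry_hol_eq_loopSum {d : ℕ} (Y : Q → Unitri p d) (hT : π (pathWord x T) = 1) (g : Q)
    (j : ℕ) : diagEntry (hol π Y (pathWord x T) g) j =
      loopSum π x T g fun v => diagEntry (Y v) j := by
  have h := (Finset.sum_range_succ' (fun i => diagEntry (Y (g * π (pathWord x i))) j) T).symm.trans
    (Finset.sum_range_succ _ T)
  rw [hT, pathWord_zero, map_one, add_left_inj] at h
  rw [diagEntry_hol_pathWord, loopSum, Finset.sum_sub_distrib, Finset.sum_sub_distrib, h]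

lemma loopSum_congr {R : Type*} [AddCommGroup R] {g : Q} {c c' : Q → R} (h : ∀ v, c v = c' v) :
    loopSum π x T g c = loopSum π x T g c' := by
  rw [funext h]

/-- Two elements of equal order represented by simple loops acquire different orders in a
suitable wreath product. -/
lemma IsSimpleLoop.exists_isPGood_orderOf_ne [Finite Q] (hp : p ≠ 2) (hπ : IsPGood p π.ker)
    (hx : IsSimpleLoop π x n (orderOf (π (pathWord x n)) * n))
    (hy : IsSimpleLoop π y n' (orderOf (π (pathWord y n')) * n'))
    (hord : orderOf (π (pathWord x n)) = orderOf (π (pathWord y n')))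
    (hconj : ¬ ∃ w, pathWord y n' = w * pathWord x n * w⁻¹ ∨
      pathWord y n' = w * (pathWord x n)⁻¹ * w⁻¹) :
    ∃ N, IsPGood p N ∧ N ≤ π.ker ∧
      ∃ k, pathWord x n ^ k ∉ N ∧ pathWord y n' ^ k ∈ N := by
  classical
  have : Fintype Q := Fintype.ofFinite Q
  have : Nonempty Q := ⟨1⟩
  choose c hc0 hc1 using hx.exists_loopSum_eq_zero (p := p) hp hy hconj
  obtain ⟨k, hk⟩ : ∃ k, Fintype.card Q ≤ p ^ k :=
    ⟨_, (Nat.lt_pow_self (Fact.out : p.Prime).one_lt).le⟩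
  let idx : ℕ → Q := fun j =>
    if h : j < Fintype.card Q then (Fintype.equivFin Q).symm ⟨j, h⟩ else 1
  have hidx : ∀ r, ∃ j < p ^ k, idx j = r := fun r =>
    ⟨Fintype.equivFin Q r, (Fintype.equivFin Q r).2.trans_le hk, by simp [idx]⟩
  let Y : Q → Unitri p (p ^ k) := fun v => unitriOf fun j => c (idx j) v
  have hY : ∀ {j}, j < p ^ k → ∀ v, diagEntry (Y v) j = c (idx j) v :=
    fun hj v => diagEntry_unitriOf _ hj
  have hpow : ∀ {z : ℕ → A × B} {l : ℕ}, Function.Periodic z l → ∀ i,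
      pathWord z l ^ i = pathWord z (i * l) := by
    intro z l hz i
    simpa using (Periodic.pathWord_mul hz i 0).symm
  have hx1 : π (pathWord x (orderOf (π (pathWord x n)) * n)) = 1 := by
    rw [← hpow hx.primitive.periodic, map_pow, pow_orderOf_eq_one]
  have hy1 : π (pathWord y (orderOf (π (pathWord y n')) * n')) = 1 := by
    rw [← hpow hy.primitive.periodic, map_pow, pow_orderOf_eq_one]
  refine ⟨(wreathHom π Y).ker, hπ.ker_wreathHom unitri_pow_eq_one Y,
    fun g hg => ((wreathHom_eq_one_iff π Y).1 hg).1,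
    orderOf (π (pathWord x n)) * p ^ k, fun h => ?_, ?_⟩
  · have h1 := ((wreathHom_eq_one_iff π Y).1 h).2 1
    rw [pow_mul, hpow hx.primitive.periodic, hol_pow π Y hx1, unitri_pow_eq_one_iff,
      Finset.prod_eq_zero_iff] at h1
    obtain ⟨j, hj, h0⟩ := h1
    rw [diagEntry_hol_eq_loopSum Y hx1, loopSum_congr (hY (Finset.mem_range.1 hj))] at h0
    exact hc1 _ h0
  · rw [hord, pow_mul, hpow hy.primitive.periodic, MonoidHom.mem_ker, wreathHom_eq_one_iff,
      map_pow, hy1, one_pow]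
    refine ⟨rfl, fun r => ?_⟩
    obtain ⟨j, hj, rfl⟩ := hidx r
    rw [hol_pow π Y hy1, unitri_pow_eq_one_iff]
    refine Finset.prod_eq_zero (Finset.mem_range.2 hj) ?_
    rw [diagEntry_hol_eq_loopSum Y hy1, loopSum_congr (hY hj), hc0]

end Splitting

section Separation

variable {A B : Type*} [Group A] [Group B]

lemma orderOf_map_conj_pow {G Q : Type*} [Group G] [Group Q] (φ : G →* Q) (h z : G) {k : ℕ}
    (hk : (orderOf (φ z)).Coprime k) : orderOf (φ (h * z ^ k * h⁻¹)) = orderOf (φ z) := by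
  rw [← hk.orderOf_pow, ← MulEquiv.orderOf_eq (MulAut.conj (φ h)) (φ z ^ k)]
  simp

lemma IsPrimitivePath.exists_isPGood_orderOf_ne [Finite A] [Finite B] {x y : ℕ → A × B}
    {n n' : ℕ} (hx : IsPrimitivePath x n) (hy : IsPrimitivePath y n') {p : ℕ} [Fact p.Prime]
    (hp : p ≠ 2)
    (hconj : ¬ ∃ w, pathWord y n' = w * pathWord x n * w⁻¹ ∨
      pathWord y n' = w * (pathWord x n)⁻¹ * w⁻¹)
    {S : Set (Coprod A B)} (hS : S.Finite) (h1 : 1 ∉ S) :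
    ∃ N, IsPGood p N ∧ (∀ g ∈ S, g ∉ N) ∧
      ∃ k, ¬ (pathWord x n ^ k ∈ N ↔ pathWord y n' ^ k ∈ N) := by
  obtain ⟨Sx, hSx, hSx1, hSx2⟩ := exists_finite_isSimpleLoop hx
  obtain ⟨Sy, hSy, hSy1, hSy2⟩ := exists_finite_isSimpleLoop hy
  obtain ⟨N, hN, hNS⟩ := exists_isPGood_forall_notMem p ((hSx.union hSy).union hS)
    (by simp [hSx1, hSy1, h1])
  by_cases hk : ∀ k, pathWord x n ^ k ∈ N ↔ pathWord y n' ^ k ∈ N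
  · have := hN.normal
    have := hN.finite
    have hmk : ∀ {g}, QuotientGroup.mk' N g = 1 ↔ g ∈ N := QuotientGroup.eq_one_iff _
    have hker : IsPGood p (QuotientGroup.mk' N).ker := by rwa [QuotientGroup.ker_mk']
    obtain ⟨M, hM, hMN, k, hkx, hky⟩ := IsSimpleLoop.exists_isPGood_orderOf_ne hp hker
      (hSx2 _ (QuotientGroup.mk' N) hker.le fun g hg h => hNS g (by simp [hg]) (hmk.1 h))
      (hSy2 _ (QuotientGroup.mk' N) hker.le fun g hg h => hNS g (by simp [hg]) (hmk.1 h))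
      (orderOf_eq_orderOf_iff.2 fun k => by rw [← map_pow, ← map_pow, hmk, hmk, hk]) hconj
    rw [QuotientGroup.ker_mk'] at hMN
    exact ⟨M, hM, fun g hg h => hNS g (by simp [hg]) (hMN h), k, by tauto⟩
  · exact ⟨N, hN, fun g hg => hNS g (by simp [hg]), not_forall.1 hk⟩

end Separation

end CartesianSplitting

/-- Key step of Lemma 3: under the hypotheses of Lemma 3 (with `m ≥ 2`), there are a
prime `p ∉ π` and a homomorphism of `G = A ∗ B` onto a finite group such that all the
`u i` map to nontrivial `p`-elements and the index set splits into two disjoint nonempty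
parts, with every order of an image coming from the first part strictly greater than
every order of an image coming from the second part. -/
theorem coprod_exists_hom_splitting (A B : Type*) [Group A] [Group B]
    [Finite A] [Finite B] (m : ℕ) (hm : 2 ≤ m) (u : Fin m → Monoid.Coprod A B)
    (huC : ∀ i, u i ∈ cartesianSubgroup A B) (hu1 : ∀ i, u i ≠ 1)
    (hcyc : ∀ i j, i ≠ j →
      ¬ ∃ (z g : Monoid.Coprod A B), u i ∈ Subgroup.zpowers z ∧
        g⁻¹ * u j * g ∈ Subgroup.zpowers z)
    (u' : Fin m → Monoid.Coprod A B) (e : Fin m → ℕ)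
    (hpow : ∀ i, u i = (u' i) ^ (e i))
    (hnpp : ∀ i, IsNotProperPower (u' i))
    (hdiv : ∀ i, 1 < e i → ∀ m' : ℕ, 0 < m' → m' ∣ e i → m' ≠ e i →
      (u' i) ^ m' ∉ cartesianSubgroup A B)
    (π : Finset ℕ) (hπ : ∀ p ∈ π, p.Prime) :
    ∃ (p : ℕ), p.Prime ∧ p ∉ π ∧
      ∃ (H : Type) (_ : Group H) (_ : Finite H) (φ : Monoid.Coprod A B →* H),
        Function.Surjective φ ∧
        (∀ i, φ (u i) ≠ 1 ∧ ∃ t : ℕ, orderOf (φ (u i)) = p ^ t) ∧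
        ∃ s : Finset (Fin m), s.Nonempty ∧ sᶜ.Nonempty ∧
          ∀ i ∈ s, ∀ j ∈ sᶜ, orderOf (φ (u j)) < orderOf (φ (u i)) := by
  classical
  have h10 : (⟨1, by omega⟩ : Fin m) ≠ ⟨0, by omega⟩ := by simp
  obtain ⟨h₀, x, n, k₀, hx, hk₀, hu₀⟩ :=
    CartesianSplitting.exists_isPrimitivePath (huC ⟨0, by omega⟩) (hu1 _)
  obtain ⟨h₁, y, n', k₁, hy, hk₁, hu₁⟩ :=
    CartesianSplitting.exists_isPrimitivePath (huC ⟨1, by omega⟩) (hu1 _)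
  obtain ⟨p, hp_le, hp⟩ := Nat.exists_infinite_primes (π.sup id + k₀ + k₁ + 3)
  have : Fact p.Prime := ⟨hp⟩
  have hpπ : p ∉ π := fun h => by
    have : p ≤ π.sup id := Finset.le_sup (f := id) h
    omega
  obtain ⟨N, hN, hNu, k, hk⟩ := hx.exists_isPGood_orderOf_ne hy (p := p) (by omega)
    (fun ⟨w, hw⟩ => by
      refine hcyc _ _ h10.symm ⟨h₀ * CartesianSplitting.pathWord x n * h₀⁻¹, h₁ * w * h₀⁻¹,
        Subgroup.mem_zpowers_iff.2 ⟨k₀, by rw [hu₀, zpow_natCast, conj_pow]⟩, ?_⟩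
      rw [hu₁, Subgroup.mem_zpowers_iff]
      rcases hw with hw | hw
      · refine ⟨k₁, ?_⟩
        rw [hw, zpow_natCast, conj_pow, conj_pow]
        group
      · refine ⟨-k₁, ?_⟩
        rw [hw, zpow_neg, zpow_natCast, conj_pow, conj_pow, inv_pow]
        group)
    (Set.finite_range u) (by rintro ⟨i, hi⟩; exact hu1 i hi)
  have := hN.normal
  have := hN.finite
  have : Small.{0} (Monoid.Coprod A B ⧸ N) := Countable.toSmall _
  let ψ : Shrink.{0} (Monoid.Coprod A B ⧸ N) ≃* Monoid.Coprod A B ⧸ N := Shrink.mulEquiv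
  let φ : Monoid.Coprod A B →* Shrink.{0} (Monoid.Coprod A B ⧸ N) :=
    ψ.symm.toMonoidHom.comp (QuotientGroup.mk' N)
  have hφ : ∀ {g}, φ g = 1 ↔ g ∈ N := by simp [φ]
  have hker : φ.ker = N := Subgroup.ext fun g => hφ
  have hord : ∀ {g}, g ∈ cartesianSubgroup A B → ∃ t, orderOf (φ g) = p ^ t :=
    (hker.symm ▸ hN : CartesianSplitting.IsPGood p φ.ker).exists_orderOf_eq hp
  have hconj : ∀ {z h : Monoid.Coprod A B} {l : ℕ}, z ∈ cartesianSubgroup A B → 0 < l → l < p →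
      orderOf (φ (h * z ^ l * h⁻¹)) = orderOf (φ z) := by
    intro z h l hz hl hlp
    obtain ⟨t, ht⟩ := hord hz
    refine CartesianSplitting.orderOf_map_conj_pow φ h z ?_
    rw [ht]
    exact Nat.Coprime.pow_left t ((hp.coprime_iff_not_dvd).2 (Nat.not_dvd_of_pos_of_lt hl hlp))
  have hne : orderOf (φ (u ⟨0, by omega⟩)) ≠ orderOf (φ (u ⟨1, by omega⟩)) := by
    rw [hu₀, hu₁, hconj hx.mem hk₀ (by omega), hconj hy.mem hk₁ (by omega)]
    intro h
    have := orderOf_eq_orderOf_iff.1 h k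
    rw [← map_pow, ← map_pow, hφ, hφ] at this
    exact hk this
  have : Nonempty (Fin m) := ⟨⟨0, by omega⟩⟩
  obtain ⟨i₀, hi₀⟩ := Finite.exists_max fun i => orderOf (φ (u i))
  refine ⟨p, hp, hpπ, _, inferInstance, inferInstance, φ,
    ψ.symm.surjective.comp (QuotientGroup.mk'_surjective N),
    fun i => ⟨fun h => hNu _ ⟨i, rfl⟩ (hφ.1 h), hord (huC i)⟩,
    Finset.univ.filter fun i => orderOf (φ (u i)) = orderOf (φ (u i₀)), ⟨i₀, by simp⟩, ?_, ?_⟩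
  · by_contra h
    rw [Finset.not_nonempty_iff_eq_empty, Finset.compl_eq_empty_iff] at h
    have h := fun i => Finset.filter_eq_self.1 h i (Finset.mem_univ i)
    exact hne ((h _).trans (h _).symm)
  · intro i hi j hj
    simp only [Finset.compl_filter, Finset.mem_filter, Finset.mem_univ, true_and] at hi hj
    rw [hi]
    exact lt_of_le_of_ne (hi₀ j) hj
end

section
/- Let G = A ∗ B be the free product of two finite groups A and B, and let u be a nontrivial element of the Cartesian subgroup C of G with u = (u')^m, where u' ∈ G is not a proper power and, if m > 1, then (u')^{m'} ∉ C for every positive divisor m' of m with m' ≠ m. Then for every prime p and every finite set S of nontrivial elements of C containing u there exists a homomorphism φ of G onto a finite group such that φ(w) is a nontrivial p-element for every w ∈ S and the order of φ(u') equals m times the order of φ(u). -/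
open Monoid.Coprod in
/-- Every element of a free product is the product of a word of nontrivial letters taken
alternately from the two factors. -/
theorem Monoid.Coprod.exists_alternating_word {A B : Type*} [Group A] [Group B]
    (g : Monoid.Coprod A B) :
    ∃ l : List (A ⊕ B), (∀ s ∈ l, s ≠ Sum.inl 1 ∧ s ≠ Sum.inr 1) ∧
      l.IsChain (fun s t ↦ s.isLeft ≠ t.isLeft) ∧
      (l.map (Sum.elim (inl : A → Monoid.Coprod A B) inr)).prod = g := by
  induction g using Monoid.Coprod.induction_on' with
  | one => exact ⟨[], by simp, by simp, by simp⟩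
  | inl_mul a x ih =>
    obtain ⟨l, hl, hc, rfl⟩ := ih
    by_cases ha : a = 1
    · exact ⟨l, hl, hc, by simp [ha]⟩
    rcases l with _ | ⟨s | s, l⟩
    · exact ⟨[Sum.inl a], by simpa using ha, by simp, by simp⟩
    · by_cases hs : a * s = 1
      · exact ⟨l, fun t ht ↦ hl t (by simp [ht]), hc.tail, by simp [← mul_assoc, ← map_mul, hs]⟩
      · refine ⟨Sum.inl (a * s) :: l, ?_, ?_, by simp [mul_assoc]⟩
        · simp only [List.mem_cons, forall_eq_or_imp] at hl ⊢
          exact ⟨by simpa using hs, hl.2⟩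
        · rw [List.isChain_cons] at hc ⊢
          exact hc
    · refine ⟨Sum.inl a :: Sum.inr s :: l, ?_, ?_, by simp⟩
      · simp only [List.mem_cons, forall_eq_or_imp] at hl ⊢
        exact ⟨by simpa using ha, hl⟩
      · simpa using hc
  | inr_mul b x ih =>
    obtain ⟨l, hl, hc, rfl⟩ := ih
    by_cases hb : b = 1
    · exact ⟨l, hl, hc, by simp [hb]⟩
    rcases l with _ | ⟨s | s, l⟩
    · exact ⟨[Sum.inr b], by simpa using hb, by simp, by simp⟩
    · refine ⟨Sum.inr b :: Sum.inl s :: l, ?_, ?_, by simp⟩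
      · simp only [List.mem_cons, forall_eq_or_imp] at hl ⊢
        exact ⟨by simpa using hb, hl⟩
      · simpa using hc
    · by_cases hs : b * s = 1
      · exact ⟨l, fun t ht ↦ hl t (by simp [ht]), hc.tail, by simp [← mul_assoc, ← map_mul, hs]⟩
      · refine ⟨Sum.inr (b * s) :: l, ?_, ?_, by simp [mul_assoc]⟩
        · simp only [List.mem_cons, forall_eq_or_imp] at hl ⊢
          exact ⟨by simpa using hs, hl.2⟩
        · rw [List.isChain_cons] at hc ⊢
          exact hc

/-- The group of upper unitriangular matrices. -/
def unitriangularGroup (n : ℕ) (R : Type*) [CommRing R] :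
    Subgroup (Matrix (Fin n) (Fin n) R)ˣ where
  carrier := {M | (∀ i j, j ≤ i → (M.val - 1) i j = 0) ∧ ∀ i j, j ≤ i → (M⁻¹.val - 1) i j = 0}
  one_mem' := by simp
  mul_mem' := by
    have key (X Y : Matrix (Fin n) (Fin n) R) (hX : ∀ i j, j ≤ i → (X - 1) i j = 0)
        (hY : ∀ i j, j ≤ i → (Y - 1) i j = 0) (i j : Fin n) (hij : j ≤ i) :
        (X * Y - 1) i j = 0 := by
      have h : X * Y - 1 = (X - 1) * (Y - 1) + (X - 1) + (Y - 1) := by noncomm_ring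
      rw [h, Matrix.add_apply, Matrix.add_apply, hX i j hij, hY i j hij, Matrix.mul_apply,
        Finset.sum_eq_zero, add_zero, add_zero]
      intro k _
      rcases le_total k i with hk | hk
      · rw [hX i k hk, zero_mul]
      · rw [hY k j (hij.trans hk), mul_zero]
    rintro M N ⟨hM, hM'⟩ ⟨hN, hN'⟩
    refine ⟨?_, ?_⟩
    · rw [Units.val_mul]
      exact key _ _ hM hN
    · rw [mul_inv_rev, Units.val_mul]
      exact key _ _ hN' hM'
  inv_mem' := by
    rintro M ⟨hM, hM'⟩
    exact ⟨hM', by simpa using hM⟩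

theorem Matrix.pow_eq_zero_of_strictlyUpperTriangular {n : ℕ} {R : Type*} [CommRing R]
    (X : Matrix (Fin n) (Fin n) R) (hX : ∀ i j, j ≤ i → X i j = 0) : X ^ n = 0 := by
  have key (k : ℕ) : ∀ i j : Fin n, (j : ℕ) < i + k → (X ^ k) i j = 0 := by
    induction k with
    | zero =>
      intro i j hij
      rw [pow_zero, Matrix.one_apply_ne]
      rintro rfl
      omega
    | succ k ih =>
      intro i j hij
      rw [pow_succ, Matrix.mul_apply]
      refine Finset.sum_eq_zero fun l _ ↦ ?_
      by_cases hl : (l : ℕ) < i + k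
      · rw [ih i l hl, zero_mul]
      · rw [hX l j (by rw [Fin.le_def]; omega), mul_zero]
  ext i j
  exact key n i j (by omega)

theorem unitriangularGroup_pow_eq_one {n : ℕ} {R : Type*} [CommRing R] (p : ℕ)
    [hp : Fact p.Prime] [CharP R p] (M : unitriangularGroup (n + 1) R) :
    M ^ p ^ (n + 1) = 1 := by
  obtain ⟨M, hM, -⟩ := M
  ext1
  ext1
  have h := add_pow_char_pow_of_commute (p := p) (n := n + 1) (Commute.one_right (M.val - 1))
  have h' : (M.val - 1) ^ p ^ (n + 1) = 0 :=
    pow_eq_zero_of_le (Nat.lt_pow_self hp.out.one_lt).le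
      (Matrix.pow_eq_zero_of_strictlyUpperTriangular _ hM)
  simpa [h'] using h

/-- The `n + 1` by `n + 1` matrix whose entries on the superdiagonal are the indicator function of
`g i = some c`, all other entries being zero. -/
def coloredShift {Γ : Type*} [DecidableEq Γ] (R : Type*) [CommRing R] (n : ℕ) (g : ℕ → Option Γ)
    (c : Γ) : Matrix (Fin (n + 1)) (Fin (n + 1)) R :=
  Matrix.of fun i j ↦ if (j : ℕ) = i + 1 ∧ g i = some c then 1 else 0

section coloredShift

variable {Γ : Type*} [DecidableEq Γ] {R : Type*} [CommRing R] {n : ℕ} {g : ℕ → Option Γ}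

theorem coloredShift_apply_of_le (c : Γ) {i j : Fin (n + 1)} (h : j ≤ i) :
    coloredShift R n g c i j = 0 := by
  rw [Fin.le_def] at h
  simp only [coloredShift, Matrix.of_apply, ite_eq_right_iff]
  omega

theorem coloredShift_mul_self (c : Γ) (hg : ∀ i, g i = some c → g (i + 1) ≠ some c) :
    coloredShift R n g c * coloredShift R n g c = 0 := by
  ext i j
  rw [Matrix.mul_apply]
  refine Finset.sum_eq_zero fun k _ ↦ ?_
  simp only [coloredShift, Matrix.of_apply]
  split_ifs with h₁ h₂ <;> simp
  exact (hg i h₁.2 (h₁.1 ▸ h₂.2)).elim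

theorem vecMul_coloredShift_succ (v : Fin (n + 1) → R) (c : Γ) (i : Fin n) :
    Matrix.vecMul v (coloredShift R n g c) i.succ =
      if g i = some c then v i.castSucc else 0 := by
  rw [Matrix.vecMul, dotProduct, Finset.sum_eq_single i.castSucc]
  · simp [coloredShift]
  · intro k _ hk
    have : ¬ ((i : ℕ) = k) := fun h ↦ hk (Fin.ext h.symm)
    simp [coloredShift, this]
  · simp

/-- The unitriangular matrix `1 + coloredShift R n g c`. -/
def coloredTransvection (R : Type*) [CommRing R] (n : ℕ) (g : ℕ → Option Γ)
    (hg : ∀ c i, g i = some c → g (i + 1) ≠ some c) (c : Γ) : unitriangularGroup (n + 1) R :=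
  ⟨⟨1 + coloredShift R n g c, 1 - coloredShift R n g c,
      by simp [add_mul, mul_sub, coloredShift_mul_self c (hg c)],
      by simp [sub_mul, mul_add, coloredShift_mul_self c (hg c)]⟩,
    fun i j hij ↦ by simp [coloredShift_apply_of_le c hij],
    fun i j hij ↦ by simp [coloredShift_apply_of_le c hij]⟩

end coloredShift

/-- A nonempty word in which no two consecutive letters involve the same generator evaluates to a
nontrivial element of a suitable finite `p`-group. -/
theorem exists_finite_pGroup_eval_ne_one {Γ : Type*} (p : ℕ) (hp : p.Prime) (L : List (Γ × Bool))
    (hL : L ≠ []) (hc : L.IsChain (fun a b ↦ a.1 ≠ b.1)) :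
    ∃ (P : Type) (_ : Group P) (_ : Finite P) (t : Γ → P),
      (∃ k : ℕ, ∀ x : P, x ^ p ^ k = 1) ∧
      (L.map fun a ↦ bif a.2 then t a.1 else (t a.1)⁻¹).prod ≠ 1 := by
  classical
  have : Fact p.Prime := ⟨hp⟩
  set n := L.length with hn
  set g : ℕ → Option Γ := fun i ↦ (L[i]?).map Prod.fst with hgdef
  have hg : ∀ c i, g i = some c → g (i + 1) ≠ some c := by
    intro c i h₁ h₂
    simp only [hgdef, Option.map_eq_some_iff, List.getElem?_eq_some_iff] at h₁ h₂
    obtain ⟨_, ⟨h₁, rfl⟩, h₁'⟩ := h₁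
    obtain ⟨_, ⟨h₂, rfl⟩, h₂'⟩ := h₂
    exact List.isChain_iff_getElem.1 hc i h₂ (h₁'.trans h₂'.symm)
  set t := coloredTransvection (ZMod p) n g hg
  refine ⟨unitriangularGroup (n + 1) (ZMod p), inferInstance, inferInstance, t,
    ⟨n + 1, unitriangularGroup_pow_eq_one p⟩, ?_⟩
  set e : Γ × Bool → unitriangularGroup (n + 1) (ZMod p) :=
    fun a ↦ bif a.2 then t a.1 else (t a.1)⁻¹
  have step (a : Γ × Bool) (v : Fin (n + 1) → ZMod p) (i : Fin n) :
      Matrix.vecMul v (e a).val.val i.succ =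
        v i.succ + (bif a.2 then 1 else -1) * if g i = some a.1 then v i.castSucc else 0 := by
    rw [← vecMul_coloredShift_succ]
    rcases a with ⟨c, _ | _⟩
    · have : (e (c, false)).val.val = 1 - coloredShift (ZMod p) n g c := rfl
      rw [this, Matrix.vecMul_sub]
      simp [sub_eq_add_neg]
    · have : (e (c, true)).val.val = 1 + coloredShift (ZMod p) n g c := rfl
      rw [this, Matrix.vecMul_add]
      simp
  have key (l : List (Γ × Bool)) : ∀ (l₀ : List (Γ × Bool)) (v : Fin (n + 1) → ZMod p),
      L = l₀ ++ l → (∀ i : Fin (n + 1), (i : ℕ) = l₀.length → v i ≠ 0) →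
      (∀ i : Fin (n + 1), l₀.length < i → v i = 0) →
      Matrix.vecMul v (l.map e).prod.val.val (Fin.last n) ≠ 0 := by
    induction l with
    | nil =>
      intro l₀ v h h₁ _
      simpa using h₁ (Fin.last n) (by simp [hn, h])
    | cons a l ih =>
      intro l₀ v h h₁ h₂
      rw [List.map_cons, List.prod_cons, Subgroup.coe_mul, Units.val_mul, ← Matrix.vecMul_vecMul]
      refine ih (l₀ ++ [a]) _ (by simpa using h) (fun i hi ↦ ?_) (fun i hi ↦ ?_)
      · simp only [List.length_append, List.length_singleton] at hi
        obtain ⟨i, rfl⟩ := Fin.exists_succ_eq.2 (show i ≠ 0 by rintro rfl; simp at hi)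
        simp only [Fin.val_succ, Nat.add_right_cancel_iff] at hi
        have hga : g i = some a.1 := by simp [hgdef, hi, h]
        rw [step, h₂ _ (by simp [hi]), if_pos hga, zero_add]
        have := h₁ i.castSucc hi
        cases a.2 <;> simpa using this
      · simp only [List.length_append, List.length_singleton] at hi
        obtain ⟨i, rfl⟩ := Fin.exists_succ_eq.2 (show i ≠ 0 by rintro rfl; simp at hi)
        simp only [Fin.val_succ, add_lt_add_iff_right] at hi
        rw [step, h₂ _ (by simp only [Fin.val_succ]; omega),
          h₂ _ (by simpa using hi)]
        simp
  intro h1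
  refine key L [] (Pi.single 0 1) rfl (fun i hi ↦ ?_) (fun i hi ↦ ?_) ?_
  · obtain rfl : i = 0 := Fin.ext hi
    simp
  · exact Pi.single_eq_of_ne (by rintro rfl; simp at hi) _
  · rw [h1]
    have : n ≠ 0 := by simpa [hn] using hL
    simpa using Pi.single_eq_of_ne (by simpa [Fin.ext_iff] using this) _

section wreath

variable {A B : Type*} [Group A] [Group B]

/-- The image in `A × B` of a letter of the free product of `A` and `B`. -/
def letterToProd : A ⊕ B → A × B :=
  Sum.elim (fun a ↦ (a, 1)) fun b ↦ (1, b)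

/-- The word in generators indexed by `Bool × (A × B)` which describes the coordinate at `x` of the
image of an alternating word under `coprodToWreath`. -/
def wreathWord : List (A ⊕ B) → A × B → List ((Bool × (A × B)) × Bool)
  | [], _ => []
  | s :: l, x => ((s.isLeft, x), true) :: ((s.isLeft, (letterToProd s)⁻¹ * x), false) ::
      wreathWord l ((letterToProd s)⁻¹ * x)

theorem wreathWord_isChain (l : List (A ⊕ B)) (hl : ∀ s ∈ l, s ≠ Sum.inl 1 ∧ s ≠ Sum.inr 1)
    (hc : l.IsChain (fun s t ↦ s.isLeft ≠ t.isLeft)) (x : A × B) :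
    (wreathWord l x).IsChain (fun a b ↦ a.1 ≠ b.1) := by
  induction l generalizing x with
  | nil => simp [wreathWord]
  | cons s l ih =>
    have ih := ih (fun t ht ↦ hl t (by simp [ht])) hc.tail ((letterToProd s)⁻¹ * x)
    have hs : letterToProd s ≠ 1 := by
      have := hl s (by simp)
      rcases s with s | s <;> simpa [letterToProd] using this
    rw [wreathWord, List.isChain_cons_cons, List.isChain_cons]
    refine ⟨by simpa using hs, ?_, ih⟩
    rcases l with _ | ⟨s', l⟩
    · simp [wreathWord]
    · rw [List.isChain_cons_cons] at hc
      simp [wreathWord, hc.1]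

variable {P : Type*} [Group P]

/-- The homomorphism to a wreath product which embeds each factor of the free product as a
conjugate, by an element of the base group, of its standard copy. -/
def coprodToWreath (t : Bool × (A × B) → P) : Monoid.Coprod A B →* RegularWreathProduct P (A × B) :=
  Monoid.Coprod.lift
    ((MulAut.conj (⟨fun x ↦ t (true, x), 1⟩ : RegularWreathProduct P (A × B))).toMonoidHom.comp
      (RegularWreathProduct.inl.comp (MonoidHom.inl A B)))
    ((MulAut.conj (⟨fun x ↦ t (false, x), 1⟩ : RegularWreathProduct P (A × B))).toMonoidHom.comp
      (RegularWreathProduct.inl.comp (MonoidHom.inr A B)))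

theorem coprodToWreath_right (t : Bool × (A × B) → P) (g : Monoid.Coprod A B) :
    (coprodToWreath t g).right = Monoid.Coprod.toProd g := by
  have : RegularWreathProduct.rightHom.comp (coprodToWreath t) = Monoid.Coprod.toProd := by
    ext x <;> simp [coprodToWreath]
  exact DFunLike.congr_fun this g

theorem coprodToWreath_letter_left (t : Bool × (A × B) → P) (s : A ⊕ B) (x : A × B) :
    (coprodToWreath t (Sum.elim Monoid.Coprod.inl Monoid.Coprod.inr s)).left x =
      t (s.isLeft, x) * (t (s.isLeft, (letterToProd s)⁻¹ * x))⁻¹ := by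
  rcases s with s | s <;> simp [coprodToWreath, letterToProd]

theorem coprodToWreath_word_left (t : Bool × (A × B) → P) (l : List (A ⊕ B)) (x : A × B) :
    (coprodToWreath t (l.map (Sum.elim Monoid.Coprod.inl Monoid.Coprod.inr)).prod).left x =
      ((wreathWord l x).map fun a ↦ bif a.2 then t a.1 else (t a.1)⁻¹).prod := by
  induction l generalizing x with
  | nil => simp [wreathWord]
  | cons s l ih =>
    have hs : Monoid.Coprod.toProd
        (Sum.elim (Monoid.Coprod.inl : A → Monoid.Coprod A B) Monoid.Coprod.inr s) =
        letterToProd s := by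
      rcases s with s | s <;> simp [letterToProd]
    rw [List.map_cons, List.prod_cons, map_mul, RegularWreathProduct.mul_left, Pi.mul_apply,
      coprodToWreath_letter_left, coprodToWreath_right, hs, ih]
    simp [wreathWord, mul_assoc]

theorem RegularWreathProduct.pow_eq_one_of_right_eq_one {D Q : Type*} [Group D] [Group Q] {k : ℕ}
    (hk : ∀ d : D, d ^ k = 1) (y : RegularWreathProduct D Q) (hy : y.right = 1) : y ^ k = 1 := by
  have key (j : ℕ) : y ^ j = ⟨y.left ^ j, 1⟩ := by
    induction j with
    | zero => rw [pow_zero, pow_zero]; rfl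
    | succ j ih => ext <;> simp [pow_succ, ih, hy]
  rw [key]
  ext x
  · exact hk _
  · rfl

end wreath

universe u v

/-- The Cartesian subgroup of a free product of finite groups is residually a finite `p`-group, in
a way compatible with finite quotients of the free product. -/
theorem exists_finite_quotient_separating {A : Type u} {B : Type v} [Group A] [Group B] [Finite A] [Finite B]
    (p : ℕ) (hp : p.Prime) (w : Monoid.Coprod A B) (hw : w ≠ 1) :
    ∃ (H : Type (max u v)) (_ : Group H) (_ : Finite H) (φ : Monoid.Coprod A B →* H),
      φ w ≠ 1 ∧ φ.ker ≤ cartesianSubgroup A B ∧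
      ∃ k : ℕ, ∀ c ∈ cartesianSubgroup A B, φ c ^ p ^ k = 1 := by
  obtain ⟨l, hl, hc, rfl⟩ := w.exists_alternating_word
  have hne : wreathWord l 1 ≠ [] := by
    rcases l with _ | ⟨s, l⟩
    · simp at hw
    · simp [wreathWord]
  obtain ⟨P, _, _, t, ⟨k, hk⟩, ht⟩ :=
    exists_finite_pGroup_eval_ne_one p hp _ hne (wreathWord_isChain l hl hc 1)
  refine ⟨RegularWreathProduct P (A × B), inferInstance, inferInstance, coprodToWreath t,
    fun h ↦ ht ?_, fun g hg ↦ ?_, k, fun c hc ↦ ?_⟩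
  · rw [← coprodToWreath_word_left, h]
    rfl
  · rw [cartesianSubgroup, MonoidHom.mem_ker, ← coprodToWreath_right t, MonoidHom.mem_ker.1 hg]
    rfl
  · refine RegularWreathProduct.pow_eq_one_of_right_eq_one hk _ ?_
    rw [coprodToWreath_right]
    exact hc

/-- Part of Lemma 2: if `G = A ∗ B` with `A`, `B` finite, `u` is a nontrivial element of
the Cartesian subgroup with `u = u' ^ m` where `u'` is not a proper power and, when
`m > 1`, no power `u' ^ m'` with `m'` a proper positive divisor of `m` lies in the
Cartesian subgroup, then for every prime `p` and every finite set `S` of nontrivial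
elements of the Cartesian subgroup containing `u` there is a homomorphism of `G` onto a
finite group mapping every element of `S` to a nontrivial `p`-element, such that the
order of the image of `u'` equals `m` times the order of the image of `u`. -/
theorem coprod_exists_hom_order_of_root (A B : Type*) [Group A] [Group B]
    [Finite A] [Finite B] (u u' : Monoid.Coprod A B) (m : ℕ)
    (huC : u ∈ cartesianSubgroup A B) (hu1 : u ≠ 1)
    (hpow : u = u' ^ m) (hnpp : IsNotProperPower u')
    (hdiv : 1 < m → ∀ m' : ℕ, 0 < m' → m' ∣ m → m' ≠ m →
      u' ^ m' ∉ cartesianSubgroup A B)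
    (p : ℕ) (hp : p.Prime) (S : Finset (Monoid.Coprod A B))
    (hSC : ∀ w ∈ S, w ∈ cartesianSubgroup A B) (hS1 : ∀ w ∈ S, w ≠ 1) (huS : u ∈ S) :
    ∃ (H : Type) (_ : Group H) (_ : Finite H) (φ : Monoid.Coprod A B →* H),
      Function.Surjective φ ∧
      (∀ w ∈ S, φ w ≠ 1 ∧ ∃ t : ℕ, orderOf (φ w) = p ^ t) ∧
      orderOf (φ u') = m * orderOf (φ u) := by
  have hm : ∀ k, u' ^ k ∈ cartesianSubgroup A B → m ∣ k := by
    have hm0 : 0 < m := Nat.pos_of_ne_zero fun h ↦ hu1 (by rw [hpow, h, pow_zero])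
    intro k hk
    have hgcd : u' ^ m.gcd k ∈ cartesianSubgroup A B := by
      have h₁ : Monoid.Coprod.toProd u' ^ m = 1 := by
        rw [← map_pow, ← hpow]
        exact huC
      have h₂ : Monoid.Coprod.toProd u' ^ k = 1 := by
        rw [← map_pow]
        exact hk
      rw [cartesianSubgroup, MonoidHom.mem_ker, map_pow]
      exact pow_gcd_eq_one.2 ⟨h₁, h₂⟩
    by_contra hmk
    have hlt : m.gcd k ≠ m := fun h ↦ hmk (Nat.gcd_eq_left_iff_dvd.1 h)
    have hm1 : m ≠ 1 := fun h ↦ hmk (h ▸ one_dvd k)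
    exact hdiv (by omega) _ (Nat.gcd_pos_of_pos_left _ hm0) (Nat.gcd_dvd_left _ _) hlt hgcd
  choose H _ _ ψ hψ hker k hk using fun w : S ↦
    exists_finite_quotient_separating p hp w.1 (hS1 w.1 w.2)
  let Ψ : Monoid.Coprod A B →* ∀ w, H w := MonoidHom.pi ψ
  have hΨker : Ψ.ker ≤ cartesianSubgroup A B := fun g hg ↦ hker ⟨u, huS⟩ (congrFun hg _)
  let e : Ψ.range ≃* Shrink.{0} Ψ.range := Shrink.mulEquiv.symm
  have hord (g : Monoid.Coprod A B) : orderOf (e (Ψ.rangeRestrict g)) = orderOf (Ψ g) := by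
    rw [MulEquiv.orderOf_eq, ← Subgroup.orderOf_coe, MonoidHom.coe_rangeRestrict]
  refine ⟨Shrink.{0} Ψ.range, inferInstance, inferInstance, e.toMonoidHom.comp Ψ.rangeRestrict,
    e.surjective.comp Ψ.rangeRestrict_surjective, fun w hw ↦ ⟨fun h ↦ ?_, ?_⟩, ?_⟩
  · refine hψ ⟨w, hw⟩ (congrFun (?_ : Ψ w = 1) _)
    have h : e (Ψ.rangeRestrict w) = 1 := h
    rw [← orderOf_eq_one_iff, hord, orderOf_eq_one_iff] at h
    exact h
  · have h1 : Ψ w ^ p ^ ∑ i, k i = 1 := by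
      ext i
      obtain ⟨d, hd⟩ := pow_dvd_pow p (Finset.single_le_sum_of_canonicallyOrdered
        (f := k) (Finset.mem_univ i))
      rw [hd, pow_mul, Pi.pow_apply, Pi.pow_apply, Pi.one_apply]
      exact (congrArg (· ^ d) (hk i w (hSC w hw))).trans (one_pow d)
    obtain ⟨j, -, hj⟩ := (Nat.dvd_prime_pow hp).1 (orderOf_dvd_of_pow_eq_one h1)
    exact ⟨j, (hord w).trans hj⟩
  · change orderOf (e (Ψ.rangeRestrict u')) = m * orderOf (e (Ψ.rangeRestrict u))
    rw [hord, hord]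
    have hpos : 0 < orderOf (Ψ u') := by
      rw [← hord]
      exact orderOf_pos _
    have hdvd : m ∣ orderOf (Ψ u') :=
      hm _ (hΨker (by rw [MonoidHom.mem_ker, map_pow, pow_orderOf_eq_one]))
    have hm0 : m ≠ 0 := by
      rintro rfl
      exact hpos.ne' (Nat.zero_dvd.1 hdvd)
    rw [hpow, map_pow, orderOf_pow_of_dvd hm0 hdvd, Nat.mul_div_cancel' hdvd]
end
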